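/- arXiv:0907.3912 — 3 statements merged into one kernel-verified Lean document; each statement's English description precedes it below -/
import Mathlib

section
/- Stanley's decomposition lemma: Let A = R/I be a standard graded artinian Gorenstein algebra of socle degree e with Hilbert function h = (h_0,…,h_e), and let L ∈ R_1 be a linear form with L ∉ I. Then R/(I : L) is a standard graded artinian Gorenstein algebra of socle degree e−1, and for every i one has h_i = b_i + c_i, where b_i = dim_k (R/(I : L))_{i−1} (the Hilbert function of R/(I : L) with indices shifted by 1, so b_1 = b_e = 1 and b_i = b_{e+1−i}) and c_i = dim_k (R/(I + (L)))_i (with c_0 = 1 and c_e = 0). -/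
open MvPolynomial

/-- The degree-`d` graded component of `R/I` (the image of the space of
degree-`d` homogeneous polynomials in the quotient), as a `k`-submodule. -/
noncomputable def gradedPiece (k : Type*) [Field k] (r : ℕ)
    (I : Ideal (MvPolynomial (Fin r) k)) (d : ℕ) :
    Submodule k (MvPolynomial (Fin r) k ⧸ I) :=
  Submodule.map (Ideal.Quotient.mkₐ k I).toLinearMap
    (homogeneousSubmodule (Fin r) k d)

/-- The Hilbert function of `R/I` in degree `d`. -/
noncomputable def hilb (k : Type*) [Field k] (r : ℕ)
    (I : Ideal (MvPolynomial (Fin r) k)) (d : ℕ) : ℕ :=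
  Module.finrank k (gradedPiece k r I d)

/-- `I` is a homogeneous ideal. -/
def IsHomogIdeal {k : Type*} [Field k] {r : ℕ}
    (I : Ideal (MvPolynomial (Fin r) k)) : Prop :=
  ∀ f ∈ I, ∀ n : ℕ, homogeneousComponent n f ∈ I

/-- `I` contains no nonzero linear forms. -/
def NoLinearForms {k : Type*} [Field k] {r : ℕ}
    (I : Ideal (MvPolynomial (Fin r) k)) : Prop :=
  ∀ f ∈ I, f.IsHomogeneous 1 → f = 0

/-- The dimension of the degree-`i` component of the socle of `R/I`. -/
noncomputable def socDim (k : Type*) [Field k] (r : ℕ)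
    (I : Ideal (MvPolynomial (Fin r) k)) (i : ℕ) : ℕ :=
  Module.finrank k (Submodule.map (Ideal.Quotient.mkₐ k I).toLinearMap
    (homogeneousSubmodule (Fin r) k i ⊓
      ⨅ j : Fin r, Submodule.comap (LinearMap.mulLeft k (X j))
        (Submodule.restrictScalars k I)))

/-- `R/I` is a standard graded artinian algebra:
`I` is homogeneous and `R/I` is finite-dimensional over `k`. -/
def StdArtinian (k : Type*) [Field k] (r : ℕ)
    (I : Ideal (MvPolynomial (Fin r) k)) : Prop :=
  IsHomogIdeal I ∧ Module.Finite k (MvPolynomial (Fin r) k ⧸ I)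

/-- `R/I` has socle degree `e`: `e` is the largest degree with nonzero
Hilbert function. -/
def SocleDegree (k : Type*) [Field k] (r : ℕ)
    (I : Ideal (MvPolynomial (Fin r) k)) (e : ℕ) : Prop :=
  hilb k r I e ≠ 0 ∧ ∀ j : ℕ, e < j → hilb k r I j = 0

/-- `R/I` is a standard graded artinian Gorenstein algebra of socle degree `e`:
the socle vanishes below degree `e` and is one-dimensional in degree `e`. -/
def Gorenstein (k : Type*) [Field k] (r e : ℕ)
    (I : Ideal (MvPolynomial (Fin r) k)) : Prop :=
  StdArtinian k r I ∧ SocleDegree k r I e ∧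
    (∀ i : ℕ, i < e → socDim k r I i = 0) ∧ socDim k r I e = 1

/-- `R/I` is a standard graded artinian level algebra of socle degree `e`. -/
def LevelAlg (k : Type*) [Field k] (r e : ℕ)
    (I : Ideal (MvPolynomial (Fin r) k)) : Prop :=
  StdArtinian k r I ∧ SocleDegree k r I e ∧
    (∀ i : ℕ, i < e → socDim k r I i = 0)

/-- The linear form with coefficient vector `c`. -/
noncomputable def linForm {k : Type*} [Field k] {r : ℕ} (c : Fin r → k) :
    MvPolynomial (Fin r) k :=
  ∑ i, C (c i) * X i

/-- A property `P` holds for a general linear form: there is a nonempty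
(basic) Zariski-open subset of the space of linear forms on which `P` holds. -/
def Generically (k : Type*) [Field k] (r : ℕ)
    (P : MvPolynomial (Fin r) k → Prop) : Prop :=
  ∃ Q : MvPolynomial (Fin r) k, Q ≠ 0 ∧
    ∀ c : Fin r → k, eval c Q ≠ 0 → P (linForm c)

/-- `R/I` has the weak Lefschetz property (socle degree `e`): multiplication
by some linear form has maximal rank from each degree `i < e` to degree `i+1`. -/
def WLP (k : Type*) [Field k] (r e : ℕ)
    (I : Ideal (MvPolynomial (Fin r) k)) : Prop :=
  ∃ L : MvPolynomial (Fin r) k, L.IsHomogeneous 1 ∧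
    ∀ i : ℕ, i < e →
      Module.finrank k (Submodule.map
        (LinearMap.mulLeft k (Ideal.Quotient.mk I L)) (gradedPiece k r I i)) =
      min (hilb k r I i) (hilb k r I (i + 1))

/-- The largest `t` with `choose t i ≤ n`: the leading top in the
`i`-binomial expansion of `n`. -/
noncomputable def binTop (n i : ℕ) : ℕ := sSup {t : ℕ | Nat.choose t i ≤ n}

/-- Auxiliary recursion computing `((n)_{(i)})⁻¹₀`, i.e. the sum
`C(n_i - 1, i) + C(n_{i-1} - 1, i-1) + ⋯ + C(n_j - 1, j)` where
`n_{(i)} = C(n_i, i) + ⋯ + C(n_j, j)` is the `i`-binomial expansion of `n`. -/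
noncomputable def greenBoundAux : ℕ → ℕ → ℕ
  | 0, _ => 0
  | (i + 1), n =>
    if n = 0 then 0 else
      Nat.choose (binTop n (i + 1) - 1) (i + 1) +
        greenBoundAux i (n - Nat.choose (binTop n (i + 1)) (i + 1))

/-- `greenBound n i = ((n)_{(i)})⁻¹₀`. -/
noncomputable def greenBound (n i : ℕ) : ℕ := greenBoundAux i n

section LinearAlgebra

variable {k V W W' : Type*} [Field k] [AddCommGroup V] [Module k V] [AddCommGroup W] [Module k W]
  [AddCommGroup W'] [Module k W']

/-- Two linear maps with the same kernel on `p` have images of `p` of the same dimension. -/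
theorem finrank_map_eq_of_ker_iff (f : V →ₗ[k] W) (g : V →ₗ[k] W') (p : Submodule k V)
    (h : ∀ x ∈ p, f x = 0 ↔ g x = 0) :
    Module.finrank k (p.map f) = Module.finrank k (p.map g) := by
  have hker : (f.domRestrict p).ker = (g.domRestrict p).ker := by
    ext x
    simpa using h x x.2
  rw [← LinearMap.range_domRestrict, ← LinearMap.range_domRestrict]
  exact ((f.domRestrict p).quotKerEquivRange.symm.trans
    ((Submodule.quotEquivOfEq _ _ hker).trans (g.domRestrict p).quotKerEquivRange)).finrank_eq

/-- Rank-nullity for the restriction of a linear map to a submodule. -/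
theorem finrank_map_add_finrank_inf_ker (f : V →ₗ[k] W) (p : Submodule k V) [Module.Finite k p] :
    Module.finrank k (p.map f) + Module.finrank k (p ⊓ f.ker : Submodule k V) =
      Module.finrank k p := by
  have h := (f.domRestrict p).finrank_range_add_finrank_ker
  rw [LinearMap.range_domRestrict, ← Submodule.finrank_map_subtype_eq] at h
  rwa [LinearMap.ker_domRestrict, Submodule.map_comap_subtype] at h

end LinearAlgebra

section GradedQuotient

variable {k : Type*} [Field k] {r : ℕ} {I : Ideal (MvPolynomial (Fin r) k)}

theorem homogeneousComponent_succ_mul {L : MvPolynomial (Fin r) k} (hL : L.IsHomogeneous 1)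
    (b : MvPolynomial (Fin r) k) (d : ℕ) :
    homogeneousComponent (d + 1) (b * L) = homogeneousComponent d b * L := by
  induction b using MvPolynomial.induction_on' with
  | monomial m c =>
    have hm := isHomogeneous_monomial (d := m) c rfl
    rw [homogeneousComponent_of_mem (hm.mul hL), homogeneousComponent_of_mem hm]
    simp only [add_left_inj, ite_mul, zero_mul]
  | add p q hp hq => rw [add_mul, map_add, hp, hq, map_add, add_mul]

theorem homogeneousComponent_zero_mul {L : MvPolynomial (Fin r) k} (hL : L.IsHomogeneous 1)
    (b : MvPolynomial (Fin r) k) :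
    homogeneousComponent 0 (b * L) = 0 := by
  have h : coeff 0 L = 0 := hL.coeff_eq_zero (by simp)
  rw [homogeneousComponent_zero, ← constantCoeff_eq, map_mul, constantCoeff_eq, h,
    mul_zero, C_0]

theorem mem_colon_span_singleton {f L : MvPolynomial (Fin r) k} :
    f ∈ I.colon (Ideal.span {L} : Ideal (MvPolynomial (Fin r) k)) ↔ f * L ∈ I := by
  rw [Submodule.mem_colon]
  refine ⟨fun h ↦ h L (Ideal.mem_span_singleton_self L), fun h p hp ↦ ?_⟩
  obtain ⟨c, rfl⟩ := Ideal.mem_span_singleton.1 hp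
  rw [smul_eq_mul, ← mul_assoc]
  exact I.mul_mem_right c h

theorem mk_mem_gradedPiece {f : MvPolynomial (Fin r) k} {d : ℕ} (hf : f.IsHomogeneous d) :
    Ideal.Quotient.mk I f ∈ gradedPiece k r I d :=
  ⟨f, hf, rfl⟩

theorem mem_gradedPiece {a : MvPolynomial (Fin r) k ⧸ I} {d : ℕ} :
    a ∈ gradedPiece k r I d ↔
      ∃ f : MvPolynomial (Fin r) k, f.IsHomogeneous d ∧ Ideal.Quotient.mk I f = a :=
  Iff.rfl

theorem hilb_eq_zero_iff [Module.Finite k (MvPolynomial (Fin r) k ⧸ I)] {d : ℕ} :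
    hilb k r I d = 0 ↔ ∀ f : MvPolynomial (Fin r) k, f.IsHomogeneous d → f ∈ I := by
  rw [hilb, Submodule.finrank_eq_zero, Submodule.eq_bot_iff]
  refine ⟨fun h f hf ↦ Ideal.Quotient.eq_zero_iff_mem.1 (h _ (mk_mem_gradedPiece hf)), ?_⟩
  rintro h _ ⟨f, hf, rfl⟩
  exact Ideal.Quotient.eq_zero_iff_mem.2 (h f hf)

theorem socDim_eq_zero_iff [Module.Finite k (MvPolynomial (Fin r) k ⧸ I)] {d : ℕ} :
    socDim k r I d = 0 ↔
      ∀ f : MvPolynomial (Fin r) k, f.IsHomogeneous d → (∀ j, X j * f ∈ I) → f ∈ I := by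
  rw [socDim, Submodule.finrank_eq_zero, Submodule.eq_bot_iff]
  constructor
  · intro h f hf hX
    refine Ideal.Quotient.eq_zero_iff_mem.1 (h _ ⟨f, ⟨hf, ?_⟩, rfl⟩)
    simpa [Submodule.mem_iInf] using hX
  · rintro h _ ⟨f, ⟨hf, hX⟩, rfl⟩
    exact Ideal.Quotient.eq_zero_iff_mem.2 (h f hf (by simpa [Submodule.mem_iInf] using hX))

/-- If everything of degree `d + 1` vanishes, then everything of degree `d` lies in the socle. -/
theorem socDim_eq_hilb {d : ℕ}
    (h : ∀ f : MvPolynomial (Fin r) k, f.IsHomogeneous (d + 1) → f ∈ I) :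
    socDim k r I d = hilb k r I d := by
  rw [socDim, hilb, gradedPiece, inf_eq_left.2]
  intro f hf
  simp only [Submodule.mem_iInf]
  intro j
  have hX := (isHomogeneous_X k j).mul ((mem_homogeneousSubmodule d f).1 hf)
  rw [add_comm] at hX
  exact h _ hX

theorem hilb_zero_eq_one (h : (1 : MvPolynomial (Fin r) k) ∉ I) : hilb k r I 0 = 1 := by
  have hspan : gradedPiece k r I 0 = k ∙ (1 : MvPolynomial (Fin r) k ⧸ I) := by
    rw [gradedPiece, homogeneousSubmodule_zero, Submodule.one_eq_span, Submodule.map_span]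
    simp
  rw [hilb, hspan]
  exact finrank_span_singleton fun h1 ↦ h (Ideal.Quotient.eq_zero_iff_mem.1 h1)

theorem one_notMem_sup_span (hI : IsHomogIdeal I) (h : (1 : MvPolynomial (Fin r) k) ∉ I)
    {L : MvPolynomial (Fin r) k} (hL : L.IsHomogeneous 1) :
    (1 : MvPolynomial (Fin r) k) ∉ I ⊔ Ideal.span {L} := by
  intro h1
  obtain ⟨b, a, ha, hab⟩ := Ideal.mem_span_singleton_sup.1 (sup_comm I _ ▸ h1)
  have h0 := hI a ha 0
  have := congrArg (homogeneousComponent 0) hab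
  rw [map_add, homogeneousComponent_zero_mul hL, zero_add,
    homogeneousComponent_eq_self (isHomogeneous_one _ _)] at this
  exact h (this ▸ h0)

theorem IsHomogIdeal.colon (hI : IsHomogIdeal I) {L : MvPolynomial (Fin r) k}
    (hL : L.IsHomogeneous 1) :
    IsHomogIdeal (I.colon (Ideal.span {L} : Ideal (MvPolynomial (Fin r) k))) := by
  intro f hf n
  rw [mem_colon_span_singleton] at hf ⊢
  rw [← homogeneousComponent_succ_mul hL]
  exact hI _ hf _

theorem StdArtinian.colon (hI : StdArtinian k r I) {L : MvPolynomial (Fin r) k}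
    (hL : L.IsHomogeneous 1) :
    StdArtinian k r (I.colon (Ideal.span {L} : Ideal (MvPolynomial (Fin r) k))) := by
  have := hI.2
  have hle : I ≤ I.colon (Ideal.span {L} : Ideal (MvPolynomial (Fin r) k)) :=
    fun f hf ↦ mem_colon_span_singleton.2 (I.mul_mem_right L hf)
  exact ⟨hI.1.colon hL, Module.Finite.of_surjective (Ideal.Quotient.factorₐ k hle).toLinearMap
    (Ideal.Quotient.factor_surjective hle)⟩

/-- The exact sequence `0 → (R/(I:L))(-1) → R/I → R/(I+(L)) → 0` in degree `d + 1`. -/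
theorem hilb_succ_eq_hilb_colon_add_hilb_sup (hI : StdArtinian k r I)
    {L : MvPolynomial (Fin r) k} (hL : L.IsHomogeneous 1) (d : ℕ) :
    hilb k r I (d + 1) =
      hilb k r (I.colon (Ideal.span {L} : Ideal (MvPolynomial (Fin r) k))) d +
        hilb k r (I ⊔ Ideal.span {L}) (d + 1) := by
  have := hI.2
  let mul : MvPolynomial (Fin r) k →ₗ[k] MvPolynomial (Fin r) k ⧸ I :=
    (Ideal.Quotient.mkₐ k I).toLinearMap ∘ₗ LinearMap.mulRight k L
  have hcolon : hilb k r (I.colon (Ideal.span {L} : Ideal (MvPolynomial (Fin r) k))) d =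
      Module.finrank k ((homogeneousSubmodule (Fin r) k d).map mul) :=
    finrank_map_eq_of_ker_iff _ _ _ fun f _ ↦
      Ideal.Quotient.eq_zero_iff_mem.trans
        (mem_colon_span_singleton.trans Ideal.Quotient.eq_zero_iff_mem.symm)
  let π := (Ideal.Quotient.factorₐ k (le_sup_left : I ≤ I ⊔ Ideal.span {L})).toLinearMap
  have hmap : (gradedPiece k r I (d + 1)).map π = gradedPiece k r (I ⊔ Ideal.span {L}) (d + 1) := by
    rw [gradedPiece, gradedPiece, ← Submodule.map_comp]
    rfl
  have hker : gradedPiece k r I (d + 1) ⊓ π.ker = (homogeneousSubmodule (Fin r) k d).map mul := by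
    ext x
    constructor
    · rintro ⟨⟨f, hf, rfl⟩, hx⟩
      have hx' : f ∈ I ⊔ Ideal.span {L} := Ideal.Quotient.eq_zero_iff_mem.1 hx
      obtain ⟨b, a, ha, hab⟩ := Ideal.mem_span_singleton_sup.1 (sup_comm I _ ▸ hx')
      refine ⟨homogeneousComponent d b, homogeneousComponent_isHomogeneous d b, ?_⟩
      have hf' := congrArg (homogeneousComponent (d + 1)) hab
      rw [map_add, homogeneousComponent_succ_mul hL, homogeneousComponent_eq_self hf] at hf'
      refine Ideal.Quotient.eq.2 ?_
      rw [← hf']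
      simpa using hI.1 a ha (d + 1)
    · rintro ⟨g, hg, rfl⟩
      refine ⟨mk_mem_gradedPiece (IsHomogeneous.mul hg hL), ?_⟩
      exact Ideal.Quotient.eq_zero_iff_mem.2
        (Ideal.mul_mem_left _ g (Ideal.mem_sup_right (Ideal.mem_span_singleton_self L)))
  rw [hcolon, ← hker, hilb, hilb, ← hmap, ← finrank_map_add_finrank_inf_ker π, add_comm]

end GradedQuotient

namespace Gorenstein

variable {k : Type*} [Field k] {r e : ℕ} {I : Ideal (MvPolynomial (Fin r) k)}

theorem mem_of_lt (h : Gorenstein k r e I) {d : ℕ} (hd : e < d) {f : MvPolynomial (Fin r) k}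
    (hf : f.IsHomogeneous d) : f ∈ I :=
  have := h.1.2
  hilb_eq_zero_iff.1 (h.2.1.2 d hd) f hf

theorem hilb_socle_degree (h : Gorenstein k r e I) : hilb k r I e = 1 :=
  (socDim_eq_hilb fun _ hf ↦ h.mem_of_lt e.lt_succ_self hf).symm.trans h.2.2.2

/-- A nonzero element of degree `i` has a nonzero multiple in the socle degree. -/
theorem exists_mul_notMem (h : Gorenstein k r e I) {i j : ℕ} (hij : i + j = e)
    {f : MvPolynomial (Fin r) k} (hf : f.IsHomogeneous i) (hfI : f ∉ I) :
    ∃ g : MvPolynomial (Fin r) k, g.IsHomogeneous j ∧ f * g ∉ I := by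
  have := h.1.2
  induction j generalizing i f with
  | zero => exact ⟨1, isHomogeneous_one _ _, by rwa [mul_one]⟩
  | succ j ih =>
    have hex : ∃ l, X l * f ∉ I := by
      by_contra! hX
      exact hfI (socDim_eq_zero_iff.1 (h.2.2.1 i (by omega)) f hf hX)
    obtain ⟨l, hl⟩ := hex
    obtain ⟨g, hg, hgI⟩ := ih (by omega : 1 + i + j = e) ((isHomogeneous_X k l).mul hf) hl
    refine ⟨X l * g, ?_, by rwa [mul_left_comm, ← mul_assoc]⟩
    rw [add_comm]
    exact (isHomogeneous_X k l).mul hg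

theorem hilb_le (h : Gorenstein k r e I) {i j : ℕ} (hij : i + j = e) :
    hilb k r I i ≤ hilb k r I j := by
  have := h.1.2
  let pairing : gradedPiece k r I i →ₗ[k] gradedPiece k r I j →ₗ[k] gradedPiece k r I e :=
    LinearMap.mk₂ k
      (fun a b ↦ ⟨a * b, by
        obtain ⟨f, hf, hfa⟩ := mem_gradedPiece.1 a.2
        obtain ⟨g, hg, hgb⟩ := mem_gradedPiece.1 b.2
        rw [← hfa, ← hgb, ← map_mul]
        exact mk_mem_gradedPiece (hij ▸ hf.mul hg)⟩)
      (fun _ _ _ ↦ Subtype.ext (add_mul _ _ _))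
      (fun _ _ _ ↦ Subtype.ext (smul_mul_assoc _ _ _))
      (fun _ _ _ ↦ Subtype.ext (mul_add _ _ _))
      (fun _ _ _ ↦ Subtype.ext (mul_smul_comm _ _ _))
  have hinj : Function.Injective pairing := by
    rw [injective_iff_map_eq_zero]
    rintro ⟨a, ha⟩ h0
    obtain ⟨f, hf, rfl⟩ := mem_gradedPiece.1 ha
    refine Subtype.ext (Ideal.Quotient.eq_zero_iff_mem.2 ?_)
    by_contra hfI
    obtain ⟨g, hg, hfg⟩ := h.exists_mul_notMem hij hf hfI
    have hz := congrArg Subtype.val (LinearMap.congr_fun h0 ⟨_, mk_mem_gradedPiece hg⟩)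
    refine hfg (Ideal.Quotient.eq_zero_iff_mem.1 ?_)
    rw [map_mul]
    exact hz
  have hle := LinearMap.finrank_le_finrank_of_injective hinj
  have h1 : Module.finrank k (gradedPiece k r I e) = 1 := h.hilb_socle_degree
  rwa [Module.finrank_linearMap, h1, mul_one] at hle

/-- The Hilbert function of a Gorenstein algebra is symmetric. -/
theorem hilb_symm (h : Gorenstein k r e I) {i j : ℕ} (hij : i + j = e) :
    hilb k r I i = hilb k r I j :=
  (h.hilb_le hij).antisymm (h.hilb_le (by omega))

theorem one_le_socle_degree (h : Gorenstein k r e I) {L : MvPolynomial (Fin r) k}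
    (hL : L.IsHomogeneous 1) (hLI : L ∉ I) : 1 ≤ e := by
  by_contra! he
  exact hLI (h.mem_of_lt he hL)

theorem colon (h : Gorenstein k r e I) {L : MvPolynomial (Fin r) k} (hL : L.IsHomogeneous 1)
    (hLI : L ∉ I) :
    Gorenstein k r (e - 1) (I.colon (Ideal.span {L} : Ideal (MvPolynomial (Fin r) k))) := by
  have he := h.one_le_socle_degree hL hLI
  have hstd := h.1.colon hL
  have := h.1.2
  have := hstd.2
  have hvanish : ∀ d, e - 1 < d → ∀ f : MvPolynomial (Fin r) k, f.IsHomogeneous d →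
      f ∈ I.colon (Ideal.span {L} : Ideal (MvPolynomial (Fin r) k)) := fun d hd f hf ↦
    mem_colon_span_singleton.2 (h.mem_of_lt (by omega) (hf.mul hL))
  have hne : hilb k r (I.colon (Ideal.span {L} : Ideal (MvPolynomial (Fin r) k))) (e - 1) ≠ 0 := by
    intro h0
    obtain ⟨g, hg, hgI⟩ := h.exists_mul_notMem (by omega : 1 + (e - 1) = e) hL hLI
    exact hgI (mul_comm L g ▸ mem_colon_span_singleton.1 (hilb_eq_zero_iff.1 h0 g hg))
  refine ⟨hstd, ⟨hne, fun d hd ↦ hilb_eq_zero_iff.2 (hvanish d hd)⟩, fun i hi ↦ ?_, ?_⟩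
  · refine socDim_eq_zero_iff.2 fun f hf hX ↦ mem_colon_span_singleton.2 ?_
    refine socDim_eq_zero_iff.1 (h.2.2.1 (i + 1) (by omega)) _ (hf.mul hL) fun j ↦ ?_
    rw [← mul_assoc]
    exact mem_colon_span_singleton.1 (hX j)
  · rw [socDim_eq_hilb (hvanish _ (Nat.lt_succ_self _))]
    have hdec := hilb_succ_eq_hilb_colon_add_hilb_sup h.1 hL (e - 1)
    rw [Nat.sub_add_cancel he, h.hilb_socle_degree] at hdec
    omega

end Gorenstein

/-- **Stanley's decomposition lemma.** Let `A = R/I` be a standard graded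
artinian Gorenstein algebra of socle degree `e` and `L ∈ R_1` a linear form
with `L ∉ I`. Then `R/(I:L)` is a standard graded artinian Gorenstein algebra
of socle degree `e-1`, and `h_i = b_i + c_i` for all `i ≥ 1`, where
`b_i = dim_k (R/(I:L))_{i-1}` (so `b_1 = b_e = 1` and `b_i = b_{e+1-i}`) and
`c_i = dim_k (R/(I+(L)))_i` (with `c_0 = 1 = h_0` and `c_e = 0`). -/
theorem stanley_decomposition
    (k : Type*) [Field k] [Infinite k]
    (r e : ℕ) (I : Ideal (MvPolynomial (Fin r) k))
    (hlin : NoLinearForms I) (hGor : Gorenstein k r e I)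
    (L : MvPolynomial (Fin r) k) (hL : L.IsHomogeneous 1) (hLI : L ∉ I) :
    Gorenstein k r (e - 1) (I.colon (Ideal.span {L})) ∧
    (∀ i : ℕ, 1 ≤ i →
      hilb k r I i =
        hilb k r (I.colon (Ideal.span {L})) (i - 1) +
        hilb k r (I ⊔ Ideal.span {L}) i) ∧
    hilb k r I 0 = hilb k r (I ⊔ Ideal.span {L}) 0 ∧
    hilb k r (I ⊔ Ideal.span {L}) 0 = 1 ∧
    hilb k r (I ⊔ Ideal.span {L}) e = 0 ∧
    hilb k r (I.colon (Ideal.span {L})) 0 = 1 ∧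
    hilb k r (I.colon (Ideal.span {L})) (e - 1) = 1 ∧
    (∀ i : ℕ, 1 ≤ i → i ≤ e →
      hilb k r (I.colon (Ideal.span {L})) (i - 1) =
        hilb k r (I.colon (Ideal.span {L})) (e - i)) := by
  have he := hGor.one_le_socle_degree hL hLI
  have hcolon := hGor.colon hL hLI
  have hdec : ∀ i : ℕ, 1 ≤ i → hilb k r I i =
      hilb k r (I.colon (Ideal.span {L})) (i - 1) + hilb k r (I ⊔ Ideal.span {L}) i := by
    intro i hi
    have h := hilb_succ_eq_hilb_colon_add_hilb_sup hGor.1 hL (i - 1)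
    rwa [Nat.sub_add_cancel hi] at h
  have h1I : (1 : MvPolynomial (Fin r) k) ∉ I := fun h ↦
    hLI (one_mul L ▸ I.mul_mem_right L h)
  have h1colon : (1 : MvPolynomial (Fin r) k) ∉ I.colon (Ideal.span {L}) := fun h ↦
    hLI (one_mul L ▸ mem_colon_span_singleton.1 h)
  have hsup := hilb_zero_eq_one (one_notMem_sup_span hGor.1.1 h1I hL)
  refine ⟨hcolon, hdec, (hilb_zero_eq_one h1I).trans hsup.symm, hsup, ?_,
    hilb_zero_eq_one h1colon, hcolon.hilb_socle_degree, fun i hi hie ↦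
      hcolon.hilb_symm (by omega)⟩
  have h := hdec e he
  rw [hGor.hilb_socle_degree, hcolon.hilb_socle_degree] at h
  omega
end

section
/- Let k be an infinite field with char k ≠ 2, and let h = (1, r, h_2, …, h_e) be the Hilbert function of a standard graded artinian Gorenstein k-algebra with r = e ≥ 2 and h_2 = e. Then: (i) h_i = e for all i = 1, 2, …, e−1; and (ii) every standard graded artinian Gorenstein k-algebra with Hilbert function h has the weak Lefschetz property. -/
open MvPolynomial

section Rank
variable {k V W X : Type*} [Field k] [AddCommGroup V] [Module k V]
  [AddCommGroup W] [Module k W] [AddCommGroup X] [Module k X]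

/-- Linear independence of a finite family survives a perturbation along a line, up to finitely
many parameters. -/
theorem LinearIndependent.finite_not_add_smul {ι : Type*} [Finite ι] {u : ι → W}
    (hu : LinearIndependent k u) (w : ι → W) :
    {t : k | ¬ LinearIndependent k (fun i => u i + t • w i)}.Finite := by
  classical
  have := Fintype.ofFinite ι
  obtain ⟨p, hp⟩ := LinearMap.exists_leftInverse_of_injective (Fintype.linearCombination k u)
    (by rw [LinearMap.ker_eq_bot]; exact linearIndependent_iff_injective_fintypeLinearCombination.1 hu)
  have hpu : ∀ i, p (u i) = Pi.single i 1 := fun i => by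
    have := LinearMap.congr_fun hp (Pi.single i 1)
    simpa [Fintype.linearCombination_apply_single] using this
  let M : Matrix ι ι k := Matrix.of fun i j => p (w i) j
  have hq : (-M).charpolyRev ≠ 0 := fun h => by
    have := Matrix.eval_charpolyRev (M := -M)
    simp [h] at this
  refine ((-M).charpolyRev.rootSet_finite k).subset fun t ht => ?_
  rw [Polynomial.mem_rootSet]
  refine ⟨hq, ?_⟩
  by_contra hne
  apply ht
  have hdet : (1 + t • M).det ≠ 0 := by
    convert hne using 1
    rw [Polynomial.coe_aeval_eq_eval, Matrix.charpolyRev, ← Polynomial.coe_evalRingHom,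
      RingHom.map_det]
    congr 1
    ext i j
    by_cases hij : i = j <;> simp [hij, mul_comm t]
  refine LinearIndependent.of_comp p ?_
  have hrows : LinearIndependent k (1 + t • M).row := Matrix.linearIndependent_rows_iff_isUnit.2
    ((Matrix.isUnit_iff_isUnit_det _).2 (hdet.isUnit))
  have heq : (fun i => p (u i + t • w i)) = (1 + t • M).row := by
    ext i j
    simp [hpu, M, Matrix.one_apply, Pi.single_apply, eq_comm (a := j)]
  change LinearIndependent k (fun i => p (u i + t • w i))
  rwa [heq]

theorem card_le_finrank_range [FiniteDimensional k V] (f : V →ₗ[k] W) {m : ℕ} (v : Fin m → V)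
    (h : LinearIndependent k (fun i => f (v i))) : m ≤ Module.finrank k (LinearMap.range f) := by
  have : LinearIndependent k (fun i => f.rangeRestrict (v i)) :=
    LinearIndependent.of_comp (LinearMap.range f).subtype h
  simpa using this.fintype_card_le_finrank

theorem exists_linearIndependent_image [FiniteDimensional k V] (f : V →ₗ[k] W) :
    ∃ v : Fin (Module.finrank k (LinearMap.range f)) → V,
      LinearIndependent k (fun i => f (v i)) ∧
      Submodule.span k (Set.range fun i => f (v i)) = LinearMap.range f := by
  let b := Module.finBasis k (LinearMap.range f)
  choose v hv using fun i => (b i).2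
  have hv' : (fun i => f (v i)) = (LinearMap.range f).subtype ∘ b := funext hv
  refine ⟨v, ?_, ?_⟩
  · rw [hv']
    exact b.linearIndependent.map' _ (Submodule.ker_subtype _)
  · rw [hv', Set.range_comp, Submodule.span_image, b.span_eq, Submodule.map_subtype_top]

theorem finite_finrank_range_add_smul_lt [FiniteDimensional k V] (f g : V →ₗ[k] W) :
    {t : k | ¬ Module.finrank k (LinearMap.range f) ≤
      Module.finrank k (LinearMap.range (f + t • g))}.Finite := by
  obtain ⟨v, hv, -⟩ := exists_linearIndependent_image f
  refine (hv.finite_not_add_smul fun i => g (v i)).subset fun t ht h => ht ?_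
  exact card_le_finrank_range _ v (by simpa using h)

theorem apply_mem_range_of_finrank_range_le [Infinite k] [FiniteDimensional k V]
    {f g : V →ₗ[k] W}
    (h : ∀ t : k, Module.finrank k (LinearMap.range (f + t • g)) ≤
      Module.finrank k (LinearMap.range f))
    {x : V} (hx : f x = 0) : g x ∈ LinearMap.range f := by
  by_contra hg
  obtain ⟨v, hv, hspan⟩ := exists_linearIndependent_image f
  have hli : LinearIndependent k (Fin.cons (g x) (fun i => f (v i)) : Fin (_ + 1) → W) :=
    hv.finCons (by rwa [hspan])
  obtain ⟨t, ht⟩ := ((hli.finite_not_add_smul (Fin.cons 0 fun i => g (v i))).union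
    (Set.finite_singleton 0)).exists_notMem
  simp only [Set.mem_union, Set.mem_ofPred_eq, Set.mem_singleton_iff, not_or, not_not] at ht
  obtain ⟨ht, ht0⟩ := ht
  have := card_le_finrank_range (f + t • g) (Fin.cons (t⁻¹ • x) v) (by
    convert ht using 1
    ext i
    refine Fin.cases ?_ (fun i => ?_) i
    · simp [hx, ht0]
    · simp)
  have := h t
  omega

theorem finrank_map_eq_of_forall_eq_zero {f : V →ₗ[k] W} {p : Submodule k V}
    (h : ∀ a ∈ p, f a = 0 → a = 0) :
    Module.finrank k (Submodule.map f p) = Module.finrank k p := by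
  rw [← LinearMap.range_domRestrict]
  refine LinearMap.finrank_range_of_inj ((injective_iff_map_eq_zero _).2 fun a ha => ?_)
  exact Subtype.ext (h a a.2 ha)

/-- A set is line-open if it contains all but finitely many points of every line through each of
its points. -/
def LineOpen (k : Type*) {V : Type*} [Field k] [AddCommGroup V] [Module k V] (U : Set V) : Prop :=
  ∀ x ∈ U, ∀ v : V, {t : k | x + t • v ∉ U}.Finite

theorem LineOpen.exists_smul [Infinite k] {U : Set V} (h : LineOpen k U) {x : V} (hx : x ∈ U)
    (v : V) : ∃ t : k, t ≠ 0 ∧ x + t • v ∈ U := by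
  obtain ⟨t, ht⟩ := ((h x hx v).union (Set.finite_singleton 0)).exists_notMem
  simp only [Set.mem_union, Set.mem_ofPred_eq, Set.mem_singleton_iff, not_or, not_not] at ht
  exact ⟨t, ht.2, ht.1⟩

theorem lineOpen_le_finrank_range [FiniteDimensional k X] (A : V →ₗ[k] X →ₗ[k] W) (m : ℕ) :
    LineOpen k {L | m ≤ Module.finrank k (LinearMap.range (A L))} := fun x hx v => by
  refine (finite_finrank_range_add_smul_lt (A x) (A v)).subset fun t ht h => ht ?_
  rw [Set.mem_ofPred_eq, map_add, map_smul]
  exact le_trans hx h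

theorem exists_sub_mem_of_finrank_le_add_three [FiniteDimensional k V] (K : Submodule k V)
    (h : Module.finrank k V ≤ Module.finrank k K + 3) (u v w : V)
    (huvw : ∀ a b c : k, a • u + b • v + c • w ∈ K → a = 0 ∧ b = 0 ∧ c = 0) (x : V) :
    ∃ a b c : k, x - (a • u + b • v + c • w) ∈ K := by
  have hli : LinearIndependent k (fun i => K.mkQ (![u, v, w] i)) := by
    refine Fintype.linearIndependent_iff.2 fun g hg => ?_
    simp only [Fin.sum_univ_three, Matrix.cons_val, ← map_smul, ← map_add] at hg
    rw [Submodule.mkQ_apply, Submodule.Quotient.mk_eq_zero] at hg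
    obtain ⟨h0, h1, h2⟩ := huvw _ _ _ hg
    intro i
    fin_cases i <;> assumption
  have htop : Submodule.span k (Set.range fun i => K.mkQ (![u, v, w] i)) = ⊤ := by
    refine Submodule.eq_top_of_finrank_eq (le_antisymm (Submodule.finrank_le _) ?_)
    rw [finrank_span_eq_card hli]
    have := K.finrank_quotient_add_finrank
    simp only [Fintype.card_fin]
    omega
  have hx : K.mkQ x ∈ Submodule.span k (Set.range fun i => K.mkQ (![u, v, w] i)) := by
    rw [htop]; trivial
  rw [Submodule.mem_span_range_iff_exists_fun] at hx
  obtain ⟨c, hc⟩ := hx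
  refine ⟨c 0, c 1, c 2, (Submodule.Quotient.mk_eq_zero K).1 ?_⟩
  rw [← Submodule.mkQ_apply, map_sub, ← hc]
  simp [Fin.sum_univ_three]

theorem exists_max_finrank_range [FiniteDimensional k X] (A : V →ₗ[k] X →ₗ[k] W) :
    ∃ L, ∀ L', Module.finrank k (LinearMap.range (A L')) ≤
      Module.finrank k (LinearMap.range (A L)) := by
  have hb : BddAbove (Set.range fun L => Module.finrank k (LinearMap.range (A L))) :=
    ⟨Module.finrank k X, by rintro _ ⟨L, rfl⟩; exact LinearMap.finrank_range_le _⟩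
  obtain ⟨L, hL⟩ := Nat.sSup_mem (Set.range_nonempty _) hb
  exact ⟨L, fun L' => (le_csSup hb ⟨L', rfl⟩).trans_eq hL.symm⟩

theorem finrank_range_eq_of_ker_eq [FiniteDimensional k V] {f : V →ₗ[k] W} {g : V →ₗ[k] X}
    (h : LinearMap.ker f = LinearMap.ker g) :
    Module.finrank k (LinearMap.range f) = Module.finrank k (LinearMap.range g) := by
  have hf := f.finrank_range_add_finrank_ker
  have hg := g.finrank_range_add_finrank_ker
  rw [h] at hf
  omega

theorem ker_eq_of_finrank_range_le [FiniteDimensional k V] {f : V →ₗ[k] W} {g : V →ₗ[k] X}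
    (hle : LinearMap.ker f ≤ LinearMap.ker g)
    (h : Module.finrank k (LinearMap.range f) ≤ Module.finrank k (LinearMap.range g)) :
    LinearMap.ker f = LinearMap.ker g := by
  refine Submodule.eq_of_le_of_finrank_le hle ?_
  have := f.finrank_range_add_finrank_ker
  have := g.finrank_range_add_finrank_ker
  omega

theorem exists_max_finrank_range_apply_self_ne_zero [Infinite k]
    [FiniteDimensional k V] (T : V →ₗ[k] V →ₗ[k] V →ₗ[k] k)
    (h12 : ∀ a b c, T a b c = T b a c) {M : V} (hM : T M M ≠ 0) :
    ∃ L, (∀ L', Module.finrank k (LinearMap.range (T L')) ≤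
      Module.finrank k (LinearMap.range (T L))) ∧ T L L ≠ 0 := by
  obtain ⟨L, hL⟩ := exists_max_finrank_range T
  by_cases h : T L L = 0
  · obtain ⟨c, hc⟩ : ∃ c, T M M c ≠ 0 := by
      by_contra! h0
      exact hM (LinearMap.ext h0)
    obtain ⟨t, ht⟩ := ((lineOpen_le_finrank_range T _ L
      (le_refl (Module.finrank k (LinearMap.range (T L)))) M).union
      ((Set.finite_singleton 0).union
      (Set.finite_singleton (-2 * T L M c / T M M c)))).exists_notMem
    simp only [Set.mem_union, Set.mem_ofPred_eq, Set.mem_singleton_iff, not_or, not_not] at ht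
    obtain ⟨ht, ht0, ht1⟩ := ht
    refine ⟨_, fun L' => (hL L').trans ht, fun h2 => ht1 ?_⟩
    have h2c := LinearMap.congr_fun h2 c
    simp only [map_add, map_smul, LinearMap.add_apply, LinearMap.smul_apply, h, h12 M L,
      LinearMap.zero_apply, smul_eq_mul] at h2c
    rw [eq_div_iff hc]
    exact mul_left_cancel₀ ht0 (by linear_combination h2c)
  · exact ⟨L, hL, h⟩

theorem exists_ker_eq_of_isotropic [FiniteDimensional k V] (T : V →ₗ[k] V →ₗ[k] V →ₗ[k] k)
    (h12 : ∀ a b c, T a b c = T b a c) (h23 : ∀ a b c, T a b c = T a c b)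
    (hT : Module.finrank k V ≤ Module.finrank k (LinearMap.ker T) + 3) {L l : V} (hLL : T L L ≠ 0)
    (hLl : T L l = 0) (hl : T l ≠ 0) (z1 : ∀ x, T x l l = 0) :
    ∃ N, LinearMap.ker (T N) ≤ LinearMap.ker T := by
  have z2 : ∀ x, T l x l = 0 := fun x => by rw [h12, z1]
  have z3 : ∀ x, T l l x = 0 := fun x => by rw [h23, z2]
  have z4 : ∀ x, T L l x = 0 := fun x => by rw [hLl, LinearMap.zero_apply]
  have z5 : ∀ x, T L x l = 0 := fun x => by rw [h23, z4]
  have z6 : ∀ x, T l L x = 0 := fun x => by rw [h12, z4]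
  have z7 : ∀ x, T l x L = 0 := fun x => by rw [h23, z6]
  have z8 : ∀ x, T x L l = 0 := fun x => by rw [h12, z5]
  obtain ⟨m, hm⟩ : ∃ m, T l m ≠ 0 := by
    by_contra! h0
    exact hl (LinearMap.ext h0)
  have hspan := exists_sub_mem_of_finrank_le_add_three (LinearMap.ker T) hT l L m (fun a b c hg => by
    have hg' : ∀ x y, a * T l x y + b * T L x y + c * T m x y = 0 := fun x y => by
      have := LinearMap.congr_fun (LinearMap.congr_fun hg x) y
      simpa only [map_add, map_smul, LinearMap.add_apply, LinearMap.smul_apply, smul_eq_mul,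
        LinearMap.zero_apply] using this
    have hc : c = 0 := by
      obtain ⟨y, hy⟩ : ∃ y, T l m y ≠ 0 := by
        by_contra! h0
        exact hm (LinearMap.ext h0)
      have := hg' l y
      simpa [z3, z4, h12 m l, hy] using this
    have hb : b = 0 := by
      obtain ⟨y, hy⟩ : ∃ y, T L L y ≠ 0 := by
        by_contra! h0
        exact hLL (LinearMap.ext h0)
      have := hg' L y
      simpa [z6, hc, hy] using this
    have ha : a = 0 := by
      simpa [hb, hc, hl] using hg
    exact ⟨ha, hb, hc⟩)
  have hexp : ∀ x, ∃ a b c : k, T x = T (a • l + b • L + c • m) ∧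
      ∀ y z, T x y z = a * T l y z + b * T L y z + c * T m y z := fun x => by
    obtain ⟨a, b, c, h⟩ := hspan x
    rw [LinearMap.mem_ker, map_sub, sub_eq_zero] at h
    exact ⟨a, b, c, h, fun y z => by
      simp only [h, map_add, map_smul, LinearMap.add_apply, LinearMap.smul_apply, smul_eq_mul]⟩
  have hmml : T m m l ≠ 0 := fun h0 => hm <| by
    ext x
    obtain ⟨a, b, c, -, h⟩ := hexp x
    rw [h12, h23, h12, h23, h, z3, z4, h23 m l, h0]
    simp
  obtain ⟨t, ht⟩ : ∃ t : k, T (m + t • L) L L ≠ 0 := by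
    by_cases h : T m L L = 0
    · refine ⟨1, fun h0 => hLL ?_⟩
      have h1 : T L L L = 0 := by simpa [h] using h0
      ext x
      obtain ⟨a, b, c, -, hx⟩ := hexp x
      rw [h23, h12, hx, h1, h, z7]
      simp
    · exact ⟨0, by simpa using h⟩
  refine ⟨m + t • L, fun x hx => ?_⟩
  rw [LinearMap.mem_ker] at hx ⊢
  have hx' : ∀ z, T x (m + t • L) z = 0 := fun z => by rw [h12, hx, LinearMap.zero_apply]
  obtain ⟨a, b, c, hTx, h⟩ := hexp x
  simp only [h] at hx'
  have hc : c = 0 := by simpa [z1, z2, z4, z5, z8, hmml] using hx' l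
  have hb : b = 0 := by
    have := hx' L
    rw [hc, z7, h12 L] at this
    simpa only [mul_zero, zero_mul, zero_add, add_zero, mul_eq_zero, ht, or_false] using this
  have ha : a = 0 := by
    simpa [hc, hb, z6, h12 l m, h23 m l m, hmml] using hx' m
  simp [hTx, ha, hb, hc]

/-- A symmetric trilinear form in at most three essential variables has a nondegenerate
(modulo its radical) contraction. -/
theorem exists_ker_eq_of_symm_trilinear [Infinite k] (hchar : (2 : k) ≠ 0)
    [FiniteDimensional k V] (T : V →ₗ[k] V →ₗ[k] V →ₗ[k] k)
    (h12 : ∀ a b c, T a b c = T b a c) (h23 : ∀ a b c, T a b c = T a c b)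
    (hT : Module.finrank k V ≤ Module.finrank k (LinearMap.ker T) + 3) :
    ∃ L, LinearMap.ker (T L) = LinearMap.ker T := by
  by_contra! hne
  have hker : ∀ L, LinearMap.ker T ≤ LinearMap.ker (T L) := fun L x hx => by
    rw [LinearMap.mem_ker] at hx ⊢
    ext y
    rw [h12, hx]; simp
  obtain ⟨M, hM⟩ : ∃ M, T M M ≠ 0 := by
    by_contra! h0
    have : T = 0 := by
      ext a b c
      have := LinearMap.congr_fun (h0 (a + b)) c
      simp only [map_add, LinearMap.add_apply, h0, LinearMap.zero_apply, h12 b a] at this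
      have h2 : 2 * T a b c = 0 := by linear_combination this
      simpa [hchar] using h2
    exact hne 0 (by simp [this])
  obtain ⟨L, hLmax, hLL⟩ := exists_max_finrank_range_apply_self_ne_zero T h12 hM
  have hiso : ∀ N a b, T L a = 0 → T L b = 0 → T N a b = 0 := fun N a b ha hb => by
    obtain ⟨w, hw⟩ := apply_mem_range_of_finrank_range_le (f := T L) (g := T N)
      (fun t => by rw [← map_smul, ← map_add]; exact hLmax _) ha
    rw [← hw, h23, hb, LinearMap.zero_apply]
  obtain ⟨l, hLl, hl⟩ := Set.exists_of_ssubset ((hker L).lt_of_ne (hne L).symm)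
  simp only [SetLike.mem_coe, LinearMap.mem_ker] at hLl hl
  obtain ⟨N, hN⟩ := exists_ker_eq_of_isotropic T h12 h23 hT hLL hLl hl
    (fun x => hiso x l l hLl hLl)
  exact hne N (le_antisymm hN (hker N))
end Rank

section Functional
variable {k S : Type*} [Field k] [CommRing S] [Algebra k S]

/-- The functional `x ↦ φ (a * x)`. -/
noncomputable def contract (φ : S →ₗ[k] k) (a : S) : S →ₗ[k] k := φ ∘ₗ LinearMap.mulLeft k a

theorem contract_apply (φ : S →ₗ[k] k) (a x : S) : contract φ a x = φ (a * x) := rfl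

/-- The bilinear form `(v, w) ↦ φ (v * w)` on `V × W`. -/
noncomputable def mulForm (φ : S →ₗ[k] k) (V W : Submodule k S) : V →ₗ[k] W →ₗ[k] k :=
  LinearMap.mk₂ k (fun v w => φ (v * w))
    (fun a b c => by simp [add_mul]) (fun t a b => by simp)
    (fun a b c => by simp [mul_add]) (fun t a b => by simp)

/-- The trilinear form `(u, v, w) ↦ φ (u * v * w)` on `V × V × W`. -/
noncomputable def mulForm₃ (φ : S →ₗ[k] k) (V W : Submodule k S) :
    V →ₗ[k] V →ₗ[k] W →ₗ[k] k :=
  LinearMap.mk₂ k (fun a b => contract φ (a * b : S) ∘ₗ W.subtype)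
    (fun a b c => by ext; simp [contract_apply, add_mul])
    (fun t a b => by ext; simp [contract_apply])
    (fun a b c => by ext; simp [contract_apply, mul_add, add_mul])
    (fun t a b => by ext; simp [contract_apply])

theorem mulForm₃_apply (φ : S →ₗ[k] k) (V W : Submodule k S) (a b : V) (c : W) :
    mulForm₃ φ V W a b c = φ (a * b * c) := rfl

theorem mulForm₃_eq (φ : S →ₗ[k] k) (V W : Submodule k S) (a : V) :
    mulForm₃ φ V W a = mulForm (contract φ a) V W := by
  ext b c
  simp [mulForm₃_apply, mulForm, contract_apply, mul_assoc]

theorem mem_ker_mulForm {φ : S →ₗ[k] k} {V W : Submodule k S} {v : V} :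
    v ∈ LinearMap.ker (mulForm φ V W) ↔ ∀ w ∈ W, φ (v * w) = 0 := by
  rw [LinearMap.mem_ker, LinearMap.ext_iff]
  exact Subtype.forall

theorem mem_ker_mulForm_mul {φ : S →ₗ[k] k} {V U W : Submodule k S} {v : V} :
    v ∈ LinearMap.ker (mulForm φ V (U * W)) ↔ ∀ u ∈ U, ∀ w ∈ W, φ (v * (u * w)) = 0 := by
  rw [mem_ker_mulForm]
  refine ⟨fun h u hu w hw => h _ (Submodule.mul_mem_mul hu hw), fun h x hx => ?_⟩
  induction hx using Submodule.mul_induction_on' with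
  | mem_mul_mem u hu w hw => exact h u hu w hw
  | add x _ y _ hx hy => rw [mul_add, map_add, hx, hy, add_zero]

theorem ker_mulForm_le_ker_contract (φ : S →ₗ[k] k) (V U W : Submodule k S) {u : S}
    (hu : u ∈ U) :
    LinearMap.ker (mulForm φ V (U * W)) ≤ LinearMap.ker (mulForm (contract φ u) V W) := by
  intro v hv
  rw [mem_ker_mulForm_mul] at hv
  rw [mem_ker_mulForm]
  intro w hw
  have := hv u hu w hw
  rwa [mul_left_comm] at this

theorem mem_ker_mulForm_contract_add_smul {φ : S →ₗ[k] k} {V W : Submodule k S} {a b : S} {t : k}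
    (ht : t ≠ 0) {v : V} (ha : v ∈ LinearMap.ker (mulForm (contract φ a) V W))
    (hab : v ∈ LinearMap.ker (mulForm (contract φ (a + t • b)) V W)) :
    v ∈ LinearMap.ker (mulForm (contract φ b) V W) := by
  rw [mem_ker_mulForm] at *
  intro w hw
  have h1 := ha w hw
  have h2 := hab w hw
  simpa [contract_apply, add_mul, ht, show φ (a * (v * w)) = 0 from h1] using h2

theorem contract_contract (φ : S →ₗ[k] k) (a b : S) :
    contract (contract φ a) b = contract (contract φ b) a := by
  ext x
  simp [contract_apply, mul_left_comm]

/-- Contraction by a suitable `L ∈ V` keeps the radical in `V` of the form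
`(v, w) ↦ φ (v * w)` on `V × V ^ (d + 2)` if that radical has codimension at most `d + 3`. -/
theorem exists_ker_mulForm_contract_eq [Infinite k] (hchar : (2 : k) ≠ 0) (V : Submodule k S)
    [FiniteDimensional k V] (d : ℕ) (φ : S →ₗ[k] k)
    (h : Module.finrank k V ≤
      Module.finrank k (LinearMap.ker (mulForm φ V (V ^ (d + 2)))) + (d + 3)) :
    ∃ L : V, LinearMap.ker (mulForm (contract φ L) V (V ^ (d + 1))) =
      LinearMap.ker (mulForm φ V (V ^ (d + 2))) := by
  induction d generalizing φ with
  | zero =>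
    have hker : LinearMap.ker (mulForm₃ φ V V) = LinearMap.ker (mulForm φ V (V ^ 2)) := by
      ext v
      rw [pow_two, mem_ker_mulForm_mul, LinearMap.mem_ker, LinearMap.ext_iff₂]
      simp only [mulForm₃_apply, mul_assoc, LinearMap.zero_apply, Subtype.forall]
    obtain ⟨L, hL⟩ := exists_ker_eq_of_symm_trilinear hchar (mulForm₃ φ V V)
      (fun a b c => by simp only [mulForm₃_apply, mul_comm (a : S)])
      (fun a b c => by simp only [mulForm₃_apply, mul_right_comm])
      (by rwa [hker])
    refine ⟨L, ?_⟩
    rw [zero_add, zero_add, ← hker, ← hL, mulForm₃_eq, pow_one]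
  | succ d ih =>
    have hpow : V ^ (d + 1 + 2) = V * V ^ (d + 2) := pow_succ' V (d + 2)
    have hpow' : V ^ (d + 2) = V * V ^ (d + 1) := pow_succ' V (d + 1)
    have hle : ∀ L : V, LinearMap.ker (mulForm φ V (V ^ (d + 1 + 2))) ≤
        LinearMap.ker (mulForm (contract φ L) V (V ^ (d + 2))) := fun L => by
      rw [hpow]
      exact ker_mulForm_le_ker_contract φ V V _ L.2
    have hle' : ∀ L M : V, LinearMap.ker (mulForm (contract φ L) V (V ^ (d + 2))) ≤
        LinearMap.ker (mulForm (contract (contract φ L) M) V (V ^ (d + 1))) := fun L M => by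
      rw [hpow']
      exact ker_mulForm_le_ker_contract _ V V _ M.2
    by_contra! hne
    obtain ⟨L, hL⟩ := exists_max_finrank_range (mulForm₃ φ V (V ^ (d + 2)))
    have hlt := Submodule.finrank_lt_finrank_of_lt ((hle L).lt_of_ne (hne L).symm)
    obtain ⟨M, hM⟩ := ih (contract φ L) (by omega)
    have hgood : ∀ P : V, Module.finrank k
        (LinearMap.range (mulForm₃ (contract φ L) V (V ^ (d + 1)) M)) ≤ Module.finrank k
        (LinearMap.range (mulForm₃ (contract φ L) V (V ^ (d + 1)) P)) →
        LinearMap.ker (mulForm (contract φ P) V (V ^ (d + 2))) =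
          LinearMap.ker (mulForm (contract φ L) V (V ^ (d + 2))) := by
      intro P hP
      rw [mulForm₃_eq, mulForm₃_eq, finrank_range_eq_of_ker_eq hM] at hP
      refine ker_eq_of_finrank_range_le ?_ ?_
      · rw [ker_eq_of_finrank_range_le (hle' L P) hP, contract_contract]
        exact hle' P L
      · rw [← mulForm₃_eq, ← mulForm₃_eq]
        exact hL P
    refine hne L (le_antisymm (fun v hv => ?_) (hle L))
    rw [hpow, mem_ker_mulForm_mul]
    intro N hN w hw
    obtain ⟨t, ht0, ht⟩ :=
      (lineOpen_le_finrank_range (mulForm₃ (contract φ L) V (V ^ (d + 1))) _).exists_smul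
        (show M ∈ {x | _ ≤ _} from le_refl (Module.finrank k
          (LinearMap.range (mulForm₃ (contract φ L) V (V ^ (d + 1)) M)))) ⟨N, hN⟩
    have hvM := hv
    rw [← hgood M le_rfl] at hvM
    have hvN := hv
    rw [← hgood _ ht] at hvN
    rw [mul_left_comm]
    exact mem_ker_mulForm.1 (mem_ker_mulForm_contract_add_smul ht0 hvM hvN) w hw

theorem mul_mem_pow_succ {V : Submodule k S} {n : ℕ} {v a : S} (hv : v ∈ V) (ha : a ∈ V ^ n) :
    v * a ∈ V ^ (n + 1) := by
  rw [pow_succ']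
  exact Submodule.mul_mem_mul hv ha

theorem finrank_pow_zero_le_one (V : Submodule k S) :
    Module.finrank k (V ^ 0 : Submodule k S) ≤ 1 := by
  rw [pow_zero, Submodule.one_eq_span]
  exact (finrank_span_le_card _).trans (by simp)

/-- In a graded algebra generated by its degree-one part `V` whose socle vanishes below degree `e`,
an element of degree `i` killed by all elements of degree `e - i` is zero. -/
theorem eq_zero_of_forall_mul_eq_zero {V : Submodule k S} {e : ℕ}
    (hsoc : ∀ i < e, ∀ a ∈ V ^ i, (∀ v ∈ V, v * a = 0) → a = 0) {i j : ℕ} (hij : i + j = e)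
    {a : S} (ha : a ∈ V ^ i) (h : ∀ b ∈ V ^ j, a * b = 0) : a = 0 := by
  induction j generalizing i a with
  | zero => simpa using h 1 (by rw [pow_zero]; exact Submodule.one_le.1 le_rfl)
  | succ j ih =>
    refine hsoc i (by omega) a ha fun v hv => ih (i := i + 1) (by omega) (mul_mem_pow_succ hv ha)
      fun b hb => ?_
    rw [mul_comm v, mul_assoc]
    exact h _ (mul_mem_pow_succ hv hb)

/-- A Gorenstein algebra with socle degree `e ≥ 3` equal to its codimension and to the dimension
of its degree-two part has a linear form that acts injectively below degree `e - 1` and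
surjectively from degree one on. -/
theorem exists_mul_injective_and_surjective [Infinite k] (hchar : (2 : k) ≠ 0)
    [Module.Finite k S] {V : Submodule k S} {e : ℕ} (he : 3 ≤ e)
    (hsoc : ∀ i < e, ∀ a ∈ V ^ i, (∀ v ∈ V, v * a = 0) → a = 0)
    {φ : S →ₗ[k] k} (hφ : ∀ a ∈ V ^ e, φ a = 0 → a = 0)
    (h1 : Module.finrank k V = e) (h2 : Module.finrank k (V ^ 2 : Submodule k S) = e) :
    ∃ L ∈ V, (∀ i, i + 2 ≤ e → ∀ a ∈ V ^ i, L * a = 0 → a = 0) ∧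
      ∀ i, 1 ≤ i → Submodule.map (LinearMap.mulLeft k L) (V ^ i) = V ^ (i + 1) := by
  obtain ⟨d, rfl⟩ : ∃ d, e = d + 3 := ⟨e - 3, by omega⟩
  obtain ⟨⟨L, hL⟩, hker⟩ := exists_ker_mulForm_contract_eq hchar V d φ (by omega)
  have hbot : LinearMap.ker (mulForm φ V (V ^ (d + 2))) = ⊥ := by
    refine (Submodule.eq_bot_iff _).2 fun v hv => ?_
    rw [mem_ker_mulForm] at hv
    refine Subtype.ext (eq_zero_of_forall_mul_eq_zero hsoc (i := 1) (j := d + 2) (by omega)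
      (by simp) fun b hb => hφ _ (mul_mem_pow_succ v.2 hb) (hv b hb))
  have hinj1 : ∀ a ∈ V, L * a = 0 → a = 0 := fun a ha hLa => by
    have : (⟨a, ha⟩ : V) ∈ LinearMap.ker (mulForm (contract φ L) V (V ^ (d + 1))) := by
      rw [mem_ker_mulForm]
      intro w _
      simp [contract_apply, ← mul_assoc, hLa]
    rw [hker, hbot] at this
    simpa using this
  have hsurj1 : Submodule.map (LinearMap.mulLeft k L) V = V ^ 2 := by
    refine Submodule.eq_of_le_of_finrank_eq ?_ ?_
    · rw [pow_two, Submodule.map_le_iff_le_comap]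
      exact fun a ha => Submodule.mul_mem_mul hL ha
    · rw [h2, finrank_map_eq_of_forall_eq_zero hinj1, h1]
  have hsurj : ∀ i, 1 ≤ i → Submodule.map (LinearMap.mulLeft k L) (V ^ i) = V ^ (i + 1) := by
    intro i hi
    induction i, hi using Nat.le_induction with
    | base => rw [pow_one, hsurj1]
    | succ i hi ih =>
      refine le_antisymm ?_ ?_
      · rw [Submodule.map_le_iff_le_comap]
        exact fun a ha => mul_mem_pow_succ hL ha
      · rw [pow_succ' V (i + 1)]
        nth_rewrite 1 [← ih]
        rw [Submodule.mul_le]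
        rintro v hv _ ⟨a, ha, rfl⟩
        exact ⟨v * a, mul_mem_pow_succ hv ha, by simp [mul_left_comm]⟩
  refine ⟨L, hL, fun i hi a ha hLa => ?_, hsurj⟩
  refine eq_zero_of_forall_mul_eq_zero hsoc (i := i) (j := d + 3 - i) (by omega) ha fun b hb => ?_
  obtain ⟨j, hj⟩ : ∃ j, d + 3 - i = j + 1 := ⟨d + 2 - i, by omega⟩
  rw [hj, ← hsurj j (by omega)] at hb
  obtain ⟨c, -, rfl⟩ := hb
  rw [LinearMap.mulLeft_apply, mul_left_comm, ← mul_assoc, hLa, zero_mul]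
end Functional

section Graded
variable {k : Type*} [Field k] {r : ℕ} {I : Ideal (MvPolynomial (Fin r) k)}

theorem gradedPiece_one_pow (n : ℕ) : gradedPiece k r I 1 ^ n = gradedPiece k r I n := by
  have h := Submodule.map_pow (homogeneousSubmodule (Fin r) k 1) (Ideal.Quotient.mkₐ k I) n
  rw [homogeneousSubmodule_one_pow] at h
  exact h.symm

theorem map_socle_le_gradedPiece (i : ℕ) :
    Submodule.map (Ideal.Quotient.mkₐ k I).toLinearMap
      (homogeneousSubmodule (Fin r) k i ⊓
        ⨅ j : Fin r, Submodule.comap (LinearMap.mulLeft k (X j))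
          (Submodule.restrictScalars k I)) ≤ gradedPiece k r I i :=
  Submodule.map_mono inf_le_left

theorem mk_X_mem_gradedPiece (j : Fin r) : Ideal.Quotient.mk I (X j) ∈ gradedPiece k r I 1 :=
  ⟨X j, isHomogeneous_X k j, rfl⟩

theorem mem_map_socle {i : ℕ} {a : MvPolynomial (Fin r) k ⧸ I} (ha : a ∈ gradedPiece k r I i)
    (h : ∀ v ∈ gradedPiece k r I 1, v * a = 0) :
    a ∈ Submodule.map (Ideal.Quotient.mkₐ k I).toLinearMap
      (homogeneousSubmodule (Fin r) k i ⊓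
        ⨅ j : Fin r, Submodule.comap (LinearMap.mulLeft k (X j))
          (Submodule.restrictScalars k I)) := by
  obtain ⟨f, hf, rfl⟩ := ha
  refine ⟨f, ⟨hf, ?_⟩, rfl⟩
  simp only [SetLike.mem_coe, Submodule.mem_iInf, Submodule.mem_comap, LinearMap.mulLeft_apply,
    Submodule.restrictScalars_mem]
  intro j
  rw [← Ideal.Quotient.eq_zero_iff_mem, map_mul]
  exact h _ (mk_X_mem_gradedPiece j)

theorem Gorenstein.eq_zero_of_forall_mul_eq_zero {e : ℕ} (hG : Gorenstein k r e I) {i : ℕ}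
    (hi : i < e) {a : MvPolynomial (Fin r) k ⧸ I} (ha : a ∈ gradedPiece k r I i)
    (h : ∀ v ∈ gradedPiece k r I 1, v * a = 0) : a = 0 := by
  have := hG.1.2
  have hmem := mem_map_socle ha h
  have h0 := hG.2.2.1 i hi
  rw [socDim, Submodule.finrank_eq_zero] at h0
  rwa [h0] at hmem

theorem Gorenstein.hilb_socleDegree {e : ℕ} (hG : Gorenstein k r e I) : hilb k r I e = 1 := by
  have := hG.1.2
  rw [← hG.2.2.2]
  refine congrArg (fun p : Submodule k (MvPolynomial (Fin r) k ⧸ I) => Module.finrank k p) ?_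
  refine le_antisymm (fun a ha => mem_map_socle ha fun v hv => ?_) (map_socle_le_gradedPiece e)
  have h0 := hG.2.1.2 (e + 1) (by omega)
  rw [hilb, Submodule.finrank_eq_zero] at h0
  have hmem : v * a ∈ gradedPiece k r I (e + 1) := by
    rw [← gradedPiece_one_pow]
    exact mul_mem_pow_succ hv (by rwa [gradedPiece_one_pow])
  rwa [h0] at hmem

end Graded

theorem exists_dual_eq_zero_imp_of_finrank_eq_one {k W : Type*} [Field k] [AddCommGroup W]
    [Module k W] {p : Submodule k W} (hp : Module.finrank k p = 1) :
    ∃ φ : W →ₗ[k] k, ∀ a ∈ p, φ a = 0 → a = 0 := by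
  obtain ⟨⟨v, hv⟩, hv0, hspan⟩ := finrank_eq_one_iff'.1 hp
  obtain ⟨φ, hφ⟩ : ∃ φ : W →ₗ[k] k, φ v ≠ 0 := by
    by_contra! h
    exact hv0 (Subtype.ext ((Module.forall_dual_apply_eq_zero_iff k v).1 h))
  refine ⟨φ, fun a ha h => ?_⟩
  obtain ⟨c, hc⟩ := hspan ⟨a, ha⟩
  have hca : c • v = a := congrArg Subtype.val hc
  rw [← hca, map_smul, smul_eq_mul, mul_eq_zero, or_iff_left hφ] at h
  rw [← hca, h, zero_smul]

/-- Theorem 3.3, second part: if `h = (1, r, h_2, …, h_e)` is the Hilbert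
function of a standard graded artinian Gorenstein algebra with `r = e ≥ 2` and
`h_2 = e`, then (i) `h_i = e` for `i = 1, …, e-1`, and (ii) every such
Gorenstein algebra has the weak Lefschetz property. -/
theorem gorenstein_h2_eq_e_wlp
    (k : Type*) [Field k] [Infinite k] (hchar : (2 : k) ≠ 0)
    (r e : ℕ) (he : 2 ≤ e)
    (I : Ideal (MvPolynomial (Fin r) k))
    (hlin : NoLinearForms I) (hGor : Gorenstein k r e I)
    (h1 : hilb k r I 1 = e) (h2 : hilb k r I 2 = e) :
    (∀ i : ℕ, 1 ≤ i → i ≤ e - 1 → hilb k r I i = e) ∧ WLP k r e I := by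
  have hfin := hGor.1.2
  have he3 : 3 ≤ e := by
    by_contra hlt
    obtain rfl : e = 2 := by omega
    have := hGor.hilb_socleDegree
    omega
  obtain ⟨φ, hφ⟩ := exists_dual_eq_zero_imp_of_finrank_eq_one hGor.hilb_socleDegree
  obtain ⟨_, ⟨L, hL, rfl⟩, hinj, hsurj⟩ := exists_mul_injective_and_surjective hchar he3
    (V := gradedPiece k r I 1) (φ := φ)
    (fun i hi a ha h => hGor.eq_zero_of_forall_mul_eq_zero hi
      (by rwa [← gradedPiece_one_pow i]) h)
    (by rwa [gradedPiece_one_pow]) h1 (by rw [gradedPiece_one_pow]; exact h2)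
  simp only [gradedPiece_one_pow] at hinj hsurj
  have hrank : ∀ i, i + 2 ≤ e → Module.finrank k (Submodule.map
      (LinearMap.mulLeft k (Ideal.Quotient.mk I L)) (gradedPiece k r I i)) = hilb k r I i :=
    fun i hi => finrank_map_eq_of_forall_eq_zero (hinj i hi)
  have hrank' : ∀ i, 1 ≤ i → Module.finrank k (Submodule.map
      (LinearMap.mulLeft k (Ideal.Quotient.mk I L)) (gradedPiece k r I i)) =
        hilb k r I (i + 1) :=
    fun i hi => congrArg (fun p : Submodule k (MvPolynomial (Fin r) k ⧸ I) =>
      Module.finrank k p) (hsurj i hi)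
  have hconst : ∀ i : ℕ, 1 ≤ i → i ≤ e - 1 → hilb k r I i = e := fun i hi => by
    induction i, hi using Nat.le_induction with
    | base => exact fun _ => h1
    | succ i hi ih =>
      intro hie
      rw [← hrank' i hi, hrank i (by omega), ih (by omega)]
  refine ⟨hconst, L, hL, fun i hi => ?_⟩
  have hlast := hGor.hilb_socleDegree
  rcases Nat.eq_zero_or_pos i with rfl | hpos
  · have h0 : hilb k r I 0 ≤ 1 := by
      rw [hilb, ← gradedPiece_one_pow]
      exact finrank_pow_zero_le_one _
    rw [hrank 0 (by omega), zero_add, h1]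
    omega
  · rw [hrank' i hpos]
    rcases Nat.lt_or_ge (i + 1) e with hlt | hge
    · rw [hconst i hpos (by omega), hconst (i + 1) (by omega) (by omega), min_self]
    · rw [show i + 1 = e by omega, hlast, hconst i hpos (by omega)]
      omega
end

section
/- Let k be an infinite field with char k ≠ 2. Then every standard graded artinian Gorenstein k-algebra with Hilbert function (1, 4, a, 4, 1) (for any integer a) has the weak Lefschetz property. -/
open MvPolynomial

section Pencil
open Module Polynomial

variable {k V U : Type*} [Field k] [AddCommGroup V] [Module k V] [FiniteDimensional k V]
  [AddCommGroup U] [Module k U]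

omit [FiniteDimensional k V] in
theorem exists_generalized_inverse (f : V →ₗ[k] U) :
    ∃ p : U →ₗ[k] V, f ∘ₗ p ∘ₗ f = f := by
  obtain ⟨s, hs⟩ := f.rangeRestrict.exists_rightInverse_of_surjective f.range_rangeRestrict
  obtain ⟨p, hp⟩ := LinearMap.exists_extend s
  refine ⟨p, LinearMap.ext fun x => ?_⟩
  have e : p (f x) = s (f.rangeRestrict x) := by
    rw [← hp]; rfl
  rw [LinearMap.comp_apply, LinearMap.comp_apply, e]
  exact congrArg Subtype.val (LinearMap.congr_fun hs (f.rangeRestrict x))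

theorem finite_setOf_not_injective_one_add_smul (h : V →ₗ[k] V) :
    {t : k | ¬ Function.Injective ((1 : V →ₗ[k] V) + t • h)}.Finite := by
  have hfin : {μ : k | Module.End.HasEigenvalue h μ}.Finite := Module.End.finite_hasEigenvalue h
  refine (hfin.image (fun μ => -μ⁻¹)).subset ?_
  intro t ht
  have ht' : LinearMap.ker ((1 : V →ₗ[k] V) + t • h) ≠ ⊥ :=
    fun hk => ht (LinearMap.ker_eq_bot.mp hk)
  obtain ⟨v, hv, hv0⟩ := (Submodule.ne_bot_iff _).mp ht'
  have hv1 : v + t • h v = 0 := by simpa using hv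
  have ht0 : t ≠ 0 := by
    rintro rfl
    exact hv0 (by simpa using hv1)
  refine ⟨-t⁻¹, ?_, by simp⟩
  refine Module.End.hasEigenvalue_of_hasEigenvector (x := v) ⟨?_, hv0⟩
  rw [Module.End.mem_eigenspace_iff, eq_comm, neg_smul, neg_eq_iff_eq_neg,
    inv_smul_eq_iff₀ ht0, smul_neg]
  exact eq_neg_of_add_eq_zero_left hv1

omit [FiniteDimensional k V] in
/-- If `p` is a generalized inverse of `f`, then `1 + t • p ∘ g` carries the kernel of `f + t • g`
into the kernel of `f`. -/
theorem ker_add_smul_le_comap_ker {f : V →ₗ[k] U} {p : U →ₗ[k] V}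
    (hp : f ∘ₗ p ∘ₗ f = f) (g : V →ₗ[k] U) (t : k) :
    LinearMap.ker (f + t • g) ≤ (LinearMap.ker f).comap ((1 : V →ₗ[k] V) + t • (p ∘ₗ g)) := by
  intro x hx
  have hx' : f x + t • g x = 0 := by simpa using hx
  have h1 : f (p (f x)) = f x := LinearMap.congr_fun hp x
  have h2 : f (p (f x + t • g x)) = 0 := by rw [hx']; simp
  simpa [h1] using h2

theorem finrank_comap_of_injective {φ : V →ₗ[k] V} (hφ : Function.Injective φ)
    (K : Submodule k V) : finrank k (K.comap φ) = finrank k K := by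
  let e := LinearEquiv.ofInjectiveEndo φ hφ
  have : K.comap φ = K.map (e.symm : V →ₗ[k] V) := by
    rw [Submodule.map_equiv_eq_comap_symm]; rfl
  rw [this]
  exact LinearEquiv.finrank_map_eq e.symm K

theorem finite_setOf_finrank_ker_lt (f g : V →ₗ[k] U) :
    {t : k | finrank k (LinearMap.ker f) < finrank k (LinearMap.ker (f + t • g))}.Finite := by
  obtain ⟨p, hp⟩ := exists_generalized_inverse f
  refine (finite_setOf_not_injective_one_add_smul (p ∘ₗ g)).subset ?_
  intro t ht hinj
  have := Submodule.finrank_mono (ker_add_smul_le_comap_ker hp g t)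
  rw [finrank_comap_of_injective hinj] at this
  exact absurd ht (not_lt.mpr this)

/-- If the kernel of `f` has minimal dimension in the pencil `f + t • g`, then each element of the
kernel of `f` deforms to second order. -/
theorem exists_second_order_deformation [Infinite k] (f g : V →ₗ[k] U)
    (hmin : ∀ t : k, finrank k (LinearMap.ker f) ≤ finrank k (LinearMap.ker (f + t • g)))
    {x : V} (hx : f x = 0) : ∃ x₁ x₂ : V, f x₁ + g x = 0 ∧ f x₂ + g x₁ = 0 := by
  obtain ⟨p, hp⟩ := exists_generalized_inverse f
  let h : V →ₗ[k] V := p ∘ₗ g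
  have hker : ∀ t : k, Function.Injective ((1 : V →ₗ[k] V) + t • h) →
      ∀ y : V, f (y + t • h y) = 0 → f y + t • g y = 0 := by
    intro t ht y hy
    have e := Submodule.eq_of_le_of_finrank_le (ker_add_smul_le_comap_ker hp g t)
      ((finrank_comap_of_injective ht _).trans_le (hmin t))
    have : y ∈ LinearMap.ker (f + t • g) := by
      rw [e]; exact hy
    simpa using this
  let b := Module.finBasis k V
  let H : Matrix _ _ k := LinearMap.toMatrix b b h
  let A : Matrix (Fin (finrank k V)) (Fin (finrank k V)) k[X] :=
    1 + (Polynomial.X : k[X]) • H.map Polynomial.C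
  let v : Fin (finrank k V) → k[X] := A.adjugate.mulVec (fun i => Polynomial.C (b.repr x i))
  have hA : ∀ t : k, A.map (Polynomial.eval t) = LinearMap.toMatrix b b (1 + t • h) := by
    intro t
    ext i j
    by_cases hij : i = j <;>
      simp [A, hij, LinearMap.toMatrix_one, H, mul_comm t]
  have hv : ∀ t : k, (fun i => (v i).eval t) =
      (LinearMap.toMatrix b b (1 + t • h)).adjugate.mulVec (b.repr x) := by
    intro t
    rw [← hA t]
    have := (Polynomial.evalRingHom t).map_adjugate A
    ext i
    rw [show A.map (Polynomial.eval t) = (Polynomial.evalRingHom t).mapMatrix A from rfl, ← this]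
    simp [v, Matrix.mulVec, dotProduct, Polynomial.eval_finsetSum]
  let w : k → V := fun t => ∑ i, (v i).eval t • b i
  have hw : ∀ t : k, ∃ c : k, w t + t • h (w t) = c • x := by
    intro t
    refine ⟨(LinearMap.toMatrix b b (1 + t • h)).det, ?_⟩
    apply b.repr.injective
    have hwr : ⇑(b.repr (w t)) = fun i => (v i).eval t := by
      exact b.repr_sum_self _
    have := LinearMap.toMatrix_mulVec_repr b b (1 + t • h) (w t)
    ext i
    have h3 := congrFun this i
    rw [hwr, hv, Matrix.mulVec_mulVec, Matrix.mul_adjugate] at h3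
    simpa [Matrix.smul_mulVec] using h3.symm
  have hw0 : w 0 = x := by
    have : (fun i => (v i).eval 0) = b.repr x := by
      rw [hv]; simp [LinearMap.toMatrix_one]
    simp only [w]
    conv_rhs => rw [← b.sum_repr x]
    exact Finset.sum_congr rfl fun i _ => by rw [← congrFun this i]
  have hzero : ∀ t : k, Function.Injective ((1 : V →ₗ[k] V) + t • h) →
      f (w t) + t • g (w t) = 0 := by
    intro t ht
    obtain ⟨c, hc⟩ := hw t
    exact hker t ht _ (by rw [hc]; simp [hx])
  let c : ℕ → V := fun n => ∑ i, (v i).coeff n • b i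
  have hc0 : c 0 = x := by
    rw [← hw0]
    simp [c, w, Polynomial.coeff_zero_eq_eval_zero]
  have key : ∀ n, f (c (n + 1)) + g (c n) = 0 := by
    intro n
    rw [← Module.forall_dual_apply_eq_zero_iff k]
    intro ξ
    let P : k[X] := ∑ i, (Polynomial.C (ξ (f (b i))) * v i +
      Polynomial.C (ξ (g (b i))) * (v i * Polynomial.X))
    have hP : P = 0 := by
      refine Polynomial.eq_zero_of_infinite_isRoot P ?_
      refine (finite_setOf_not_injective_one_add_smul h).infinite_compl.mono ?_
      intro t ht
      have ht' : Function.Injective ((1 : V →ₗ[k] V) + t • h) := not_not.mp ht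
      have := congrArg ξ (hzero t ht')
      simp only [w, map_sum, map_add, map_smul, smul_eq_mul, map_zero] at this
      rw [Set.mem_ofPred_eq, Polynomial.IsRoot.def, ← this, Finset.mul_sum,
        ← Finset.sum_add_distrib]
      simp only [P, Polynomial.eval_finsetSum]
      refine Finset.sum_congr rfl fun i _ => ?_
      simp
      ring
    have := congrArg (fun q : k[X] => q.coeff (n + 1)) hP
    simp only [P, Polynomial.finsetSum_coeff, Polynomial.coeff_add, Polynomial.coeff_C_mul,
      Polynomial.coeff_mul_X, Polynomial.coeff_zero] at this
    rw [← this]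
    simp only [c, map_sum, map_add, map_smul, smul_eq_mul]
    rw [← Finset.sum_add_distrib]
    refine Finset.sum_congr rfl fun i _ => ?_
    ring
  exact ⟨c 1, c 2, by simpa [hc0] using key 0, key 1⟩

theorem finrank_lt_two_mul_finrank_ker {f g : V →ₗ[k] U}
    (hle : LinearMap.range f ≤ (LinearMap.ker f).map g) {x : V} (hx0 : x ≠ 0) (hf : f x = 0)
    (hg : g x = 0) : finrank k V < 2 * finrank k (LinearMap.ker f) := by
  have hrange := LinearMap.finrank_range_add_finrank_ker f
  have hres := LinearMap.finrank_range_add_finrank_ker (g.domRestrict (LinearMap.ker f))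
  rw [LinearMap.range_domRestrict] at hres
  have hker : 1 ≤ finrank k (LinearMap.ker (g.domRestrict (LinearMap.ker f))) :=
    Submodule.one_le_finrank_iff.mpr ((Submodule.ne_bot_iff _).mpr
      ⟨⟨x, hf⟩, hg, fun h => hx0 (congrArg Subtype.val h)⟩)
  have := Submodule.finrank_mono hle
  omega

end Pencil

section LinearAnnihilators
open Module

variable {k B : Type*} [Field k] [CommRing B] [Algebra k B] (V : Submodule k B)

/-- Multiplication of two elements of a subspace `V` of a `k`-algebra. -/
def mulOn : V →ₗ[k] V →ₗ[k] B := (LinearMap.mul k B).domRestrict₁₂ V V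

@[simp] theorem mulOn_apply (x y : V) : mulOn V x y = (x : B) * y := rfl

/-- `L ∈ V` annihilates a subspace of `V` of the smallest possible dimension. -/
def IsGenericOn (L : V) : Prop :=
  ∀ M : V, finrank k (LinearMap.ker (mulOn V L)) ≤ finrank k (LinearMap.ker (mulOn V M))

theorem exists_isGenericOn : ∃ L : V, IsGenericOn V L := by
  let d : V → ℕ := fun L => finrank k (LinearMap.ker (mulOn V L))
  exact ⟨Function.argmin d, fun M => Function.argmin_le d M⟩

variable {V}

/-- Generic elements can be found outside two given proper subspaces. -/
theorem exists_isGenericOn_notMem [Infinite k] [FiniteDimensional k V] {W₁ W₂ : Submodule k V}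
    (h₁ : W₁ ≠ ⊤) (h₂ : W₂ ≠ ⊤) : ∃ L : V, IsGenericOn V L ∧ L ∉ W₁ ∧ L ∉ W₂ := by
  obtain ⟨L, hL⟩ := exists_isGenericOn V
  obtain ⟨M, hM₁, hM₂⟩ : ∃ M : V, M ∉ W₁ ∧ M ∉ W₂ := by
    obtain ⟨a, -, ha⟩ := SetLike.exists_of_lt h₁.lt_top
    obtain ⟨b, -, hb⟩ := SetLike.exists_of_lt h₂.lt_top
    by_cases ha' : a ∈ W₂
    · by_cases hb' : b ∈ W₁
      · exact ⟨a + b, fun h => ha ((W₁.add_mem_iff_left hb').mp h),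
          fun h => hb ((W₂.add_mem_iff_right ha').mp h)⟩
      · exact ⟨b, hb', hb⟩
    · exact ⟨a, ha, ha'⟩
  have hfin : ∀ W : Submodule k V, M ∉ W → {t : k | L + t • M ∈ W}.Finite := by
    intro W hW
    refine Set.Subsingleton.finite ?_
    intro s hs t ht
    by_contra hst
    have : (s - t) • M ∈ W := by
      have := W.sub_mem hs ht
      rwa [add_sub_add_left_eq_sub, ← sub_smul s t M] at this
    exact hW ((W.smul_mem_iff (sub_ne_zero.mpr hst)).mp this)
  obtain ⟨t, ht⟩ := (((finite_setOf_finrank_ker_lt (mulOn V L) (mulOn V M)).union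
    ((hfin W₁ hM₁).union (hfin W₂ hM₂))).infinite_compl).nonempty
  simp only [Set.mem_compl_iff, Set.mem_union, not_or] at ht
  obtain ⟨ht, ht₁, ht₂⟩ := ht
  refine ⟨L + t • M, fun N => ?_, ht₁, ht₂⟩
  rw [map_add, map_smul]
  exact (not_lt.mp ht).trans (hL N)

section GenericAnnihilator

variable [Infinite k] [FiniteDimensional k V]
  (hsoc₂ : ∀ x y : V, (∀ z : V, (x * y * z : B) = 0) → (x * y : B) = 0)

theorem IsGenericOn.exists_deformation {L : V} (hL : IsGenericOn V L) {x : V}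
    (hx : (L * x : B) = 0) (M : V) :
    ∃ x₁ x₂ : V, (L * x₁ + M * x : B) = 0 ∧ (L * x₂ + M * x₁ : B) = 0 :=
  exists_second_order_deformation (mulOn V L) (mulOn V M)
    (fun t => by
      have := hL (L + t • M)
      rwa [map_add, map_smul] at this) hx

include hsoc₂ in
theorem IsGenericOn.mul_eq_zero {L : V} (hL : IsGenericOn V L) {x y : V}
    (hx : (L * x : B) = 0) (hy : (L * y : B) = 0) : (x * y : B) = 0 := by
  refine hsoc₂ x y fun M => ?_
  obtain ⟨x₁, -, h, -⟩ := hL.exists_deformation hx M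
  linear_combination (y : B) * h - (x₁ : B) * hy

include hsoc₂ in
/-- If `x ∈ V` is annihilated by a generic `L`, then `x V ⊆ L W` for `W` the annihilator of `x`
in `V`. -/
theorem IsGenericOn.exists_mul_eq_mul (hchar : (2 : k) ≠ 0) {L : V} (hL : IsGenericOn V L) {x : V}
    (hx : (L * x : B) = 0) (M : V) : ∃ y : V, (x * y : B) = 0 ∧ (x * M : B) = L * y := by
  choose x₁ x₂ h₁ h₂ using hL.exists_deformation hx
  have hdiag : ∀ M : V, (x * x₁ M * M : B) = 0 := fun M => by
    linear_combination (x : B) * h₂ M - (x₂ M : B) * hx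
  have hsymm : ∀ M N : V, (x * x₁ M * N : B) = x * x₁ N * M := fun M N => by
    linear_combination (x₁ M : B) * h₁ N - (x₁ N : B) * h₁ M
  have hzero : ∀ M N : V, (x * x₁ M * N : B) = 0 := by
    intro M N
    have h := hdiag (M + N)
    have hM := hsymm (M + N) M
    have hN := hsymm (M + N) N
    rw [Submodule.coe_add] at h hM hN
    have : (2 : k) • (x * x₁ M * N : B) = 0 := by
      rw [two_smul]
      linear_combination h - hM - hN - hdiag M - hdiag N + hsymm M N
    exact (smul_eq_zero_iff_right hchar).mp this
  refine ⟨-x₁ M, ?_, ?_⟩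
  · rw [Submodule.coe_neg, mul_neg, hsoc₂ x _ (hzero M), neg_zero]
  · rw [Submodule.coe_neg]
    linear_combination h₁ M

variable (hsoc₁ : ∀ x : V, (∀ y : V, (x * y : B) = 0) → x = 0)

include hsoc₁ hsoc₂ in
theorem IsGenericOn.finrank_annihilator (hchar : (2 : k) ≠ 0) (hV : finrank k V = 4) {L : V}
    (hL : IsGenericOn V L) {x : V} (hx0 : x ≠ 0) (hx : (L * x : B) = 0) :
    finrank k (LinearMap.ker (mulOn V x)) = 3 := by
  have hlt : finrank k (LinearMap.ker (mulOn V x)) < finrank k V := by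
    refine Submodule.finrank_lt fun h => hx0 (hsoc₁ x fun y => ?_)
    rw [← mulOn_apply, ← LinearMap.mem_ker, h]
    exact Submodule.mem_top
  have hgt : finrank k V < 2 * finrank k (LinearMap.ker (mulOn V x)) := by
    refine finrank_lt_two_mul_finrank_ker (g := mulOn V L) ?_ hx0 (hL.mul_eq_zero hsoc₂ hx hx) hx
    rintro _ ⟨M, rfl⟩
    obtain ⟨y, hy, hM⟩ := hL.exists_mul_eq_mul hsoc₂ hchar hx M
    exact ⟨y, hy, hM.symm⟩
  omega

omit [Infinite k] in
include hsoc₂ in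
/-- If the annihilator of `x` in `V` is a hyperplane, then `x y z = 0` only if `x y = 0`
or `x z = 0`. -/
theorem mul_eq_zero_or_of_hyperplane (hV : finrank k V = 4) {x : V}
    (hx : finrank k (LinearMap.ker (mulOn V x)) = 3) {y z : V} (hyz : (x * y * z : B) = 0) :
    (x * y : B) = 0 ∨ (x * z : B) = 0 := by
  rw [or_iff_not_imp_left]
  intro hy
  have hspan : ∀ v : V, ∃ c : k, (x * v : B) = c • (x * y : B) := by
    have hr : finrank k (LinearMap.range (mulOn V x)) = 1 := by
      have := LinearMap.finrank_range_add_finrank_ker (mulOn V x)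
      omega
    intro v
    obtain ⟨c, hc⟩ := (finrank_eq_one_iff_of_nonzero' (⟨x * y, ⟨y, rfl⟩⟩ :
      LinearMap.range (mulOn V x)) (fun h => hy (congrArg Subtype.val h))).mp hr
      ⟨x * v, ⟨v, rfl⟩⟩
    exact ⟨c, (congrArg Subtype.val hc).symm⟩
  refine hsoc₂ x z fun v => ?_
  obtain ⟨c, hc⟩ := hspan v
  rw [mul_right_comm, hc, Algebra.smul_mul_assoc, hyz, smul_zero]

omit [Infinite k] in
include hsoc₂ in
theorem mul_eq_zero_of_annihilators_ne (hV : finrank k V = 4) {x y : V}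
    (hx : finrank k (LinearMap.ker (mulOn V x)) = 3)
    (hy : finrank k (LinearMap.ker (mulOn V y)) = 3)
    (hne : LinearMap.ker (mulOn V x) ≠ LinearMap.ker (mulOn V y)) : (x * y : B) = 0 := by
  by_contra hxy
  refine hne (Submodule.eq_of_le_of_finrank_eq (fun z hz => ?_) (hx.trans hy.symm))
  have hz' : (x * z : B) = 0 := hz
  refine (mul_eq_zero_or_of_hyperplane hsoc₂ hV hy (y := x) (z := z) ?_).resolve_left ?_
  · linear_combination (y : B) * hz'
  · rwa [mul_comm]

include hsoc₁ hsoc₂ in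
/-- In a four-dimensional space `V` of elements of a commutative algebra, if no nonzero element of
`V` is annihilated by `V` and no nonzero product of two elements of `V` is annihilated by `V`, then
multiplication by some element of `V` is injective on `V`. -/
theorem exists_forall_mul_eq_zero (hchar : (2 : k) ≠ 0) (hV : finrank k V = 4) :
    ∃ L : V, ∀ x : V, (L * x : B) = 0 → x = 0 := by
  by_contra! hcon
  have hW : ∀ {L x : V}, IsGenericOn V L → x ≠ 0 → (L * x : B) = 0 →
      finrank k (LinearMap.ker (mulOn V x)) = 3 :=
    fun hL hx0 hx => hL.finrank_annihilator hsoc₂ hsoc₁ hchar hV hx0 hx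
  have htop : ∀ {W : Submodule k V}, finrank k W = 3 → W ≠ ⊤ := by
    rintro W h rfl
    rw [finrank_top] at h
    omega
  obtain ⟨L₁, hL₁⟩ := exists_isGenericOn V
  obtain ⟨x₁, hx₁, h0₁⟩ := hcon L₁
  have hW₁ := hW hL₁ h0₁ hx₁
  obtain ⟨L₂, hL₂, hL₂₁, -⟩ := exists_isGenericOn_notMem (htop hW₁) (htop hW₁)
  obtain ⟨x₂, hx₂, h0₂⟩ := hcon L₂
  have hW₂ := hW hL₂ h0₂ hx₂
  obtain ⟨L₃, hL₃, hL₃₁, hL₃₂⟩ := exists_isGenericOn_notMem (htop hW₁) (htop hW₂)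
  obtain ⟨x₃, hx₃, h0₃⟩ := hcon L₃
  have hW₃ := hW hL₃ h0₃ hx₃
  have hmem : ∀ {L x : V}, (L * x : B) = 0 → L ∈ LinearMap.ker (mulOn V x) := fun h => by
    rw [LinearMap.mem_ker, mulOn_apply, mul_comm, h]
  set W₁ := LinearMap.ker (mulOn V x₁) with hW₁_def
  set W₂ := LinearMap.ker (mulOn V x₂) with hW₂_def
  set W₃ := LinearMap.ker (mulOn V x₃) with hW₃_def
  have hne₁₂ : W₁ ≠ W₂ := fun h => hL₂₁ (h ▸ hmem hx₂)
  have hne₁₃ : W₁ ≠ W₃ := fun h => hL₃₁ (h ▸ hmem hx₃)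
  have hne₂₃ : W₂ ≠ W₃ := fun h => hL₃₂ (h ▸ hmem hx₃)
  have h₁₁ : (x₁ * x₁ : B) = 0 := hL₁.mul_eq_zero hsoc₂ hx₁ hx₁
  have h₂₂ : (x₂ * x₂ : B) = 0 := hL₂.mul_eq_zero hsoc₂ hx₂ hx₂
  have h₁₂ : (x₁ * x₂ : B) = 0 := mul_eq_zero_of_annihilators_ne hsoc₂ hV hW₁ hW₂ hne₁₂
  have h₁₃ : (x₁ * x₃ : B) = 0 := mul_eq_zero_of_annihilators_ne hsoc₂ hV hW₁ hW₃ hne₁₃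
  have h₂₃ : (x₂ * x₃ : B) = 0 := mul_eq_zero_of_annihilators_ne hsoc₂ hV hW₂ hW₃ hne₂₃
  have hker_smul : ∀ {x y : V} {c : k}, y ≠ 0 → c • x = y →
      LinearMap.ker (mulOn V x) = LinearMap.ker (mulOn V y) := by
    rintro x _ c hy rfl
    rw [map_smul, LinearMap.ker_smul _ _ (fun h => hy (by rw [h, zero_smul]))]
  have hinf : finrank k (W₁ ⊓ W₂ : Submodule k V) ≤ 2 := by
    have hlt : W₁ ⊓ W₂ < W₁ := by
      refine lt_of_le_of_ne inf_le_left fun h => hne₁₂ ?_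
      exact Submodule.eq_of_le_of_finrank_eq (inf_eq_left.mp h) (hW₁.trans hW₂.symm)
    have := Submodule.finrank_lt_finrank_of_lt hlt
    omega
  have hli : LinearIndependent k ![x₁, x₂] :=
    (LinearIndependent.pair_iff' h0₁).mpr fun c hc => hne₁₂ (hker_smul h0₂ hc)
  have hspan : Submodule.span k {x₁, x₂} = W₁ ⊓ W₂ := by
    refine Submodule.eq_of_le_of_finrank_le ?_ ?_
    · rw [Submodule.span_le]
      rintro _ (rfl | rfl)
      · exact ⟨h₁₁, by simpa [W₂, mul_comm] using h₁₂⟩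
      · exact ⟨h₁₂, h₂₂⟩
    · have := finrank_span_eq_card hli
      rw [Matrix.range_cons_cons_empty, Fintype.card_fin] at this
      omega
  obtain ⟨α, β, hαβ⟩ : ∃ α β : k, α • x₁ + β • x₂ = x₃ := by
    rw [← Submodule.mem_span_pair, hspan]
    exact ⟨h₁₃, h₂₃⟩
  have hα : α ≠ 0 := by
    rintro rfl
    exact hne₂₃ (hker_smul h0₃ (by simpa using hαβ))
  have hβ : β ≠ 0 := by
    rintro rfl
    exact hne₁₃ (hker_smul h0₃ (by simpa using hαβ))
  obtain ⟨u, hu₂, hu₁⟩ := SetLike.not_le_iff_exists.mp fun h : W₂ ≤ W₁ =>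
    hne₁₂ (Submodule.eq_of_le_of_finrank_eq h (hW₂.trans hW₁.symm)).symm
  obtain ⟨v, hv₁, hv₂⟩ := SetLike.not_le_iff_exists.mp fun h : W₁ ≤ W₂ =>
    hne₁₂ (Submodule.eq_of_le_of_finrank_eq h (hW₁.trans hW₂.symm))
  have hx₃_mul : ∀ y : V, (x₃ * y : B) = α • (x₁ * y : B) + β • (x₂ * y : B) := by
    intro y
    rw [← hαβ]
    simp [add_mul]
  have hu₂' : (x₂ * u : B) = 0 := hu₂
  have hv₁' : (x₁ * v : B) = 0 := hv₁
  have huv : (x₃ * u * v : B) = 0 := by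
    rw [hx₃_mul, hu₂', smul_zero, add_zero, Algebra.smul_mul_assoc, mul_right_comm, hv₁', zero_mul,
      smul_zero]
  rcases mul_eq_zero_or_of_hyperplane hsoc₂ hV hW₃ huv with h | h
  · rw [hx₃_mul, hu₂', smul_zero, add_zero] at h
    exact hu₁ ((smul_eq_zero_iff_right hα).mp h)
  · rw [hx₃_mul, hv₁', smul_zero, zero_add] at h
    exact hv₂ ((smul_eq_zero_iff_right hβ).mp h)

end GenericAnnihilator

end LinearAnnihilators

section GradedPieces
open Module

variable {k : Type*} [Field k] {r : ℕ} {I : Ideal (MvPolynomial (Fin r) k)}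

theorem mul_mem_gradedPiece {i j n : ℕ} (hij : i + j = n) {x y : MvPolynomial (Fin r) k ⧸ I}
    (hx : x ∈ gradedPiece k r I i) (hy : y ∈ gradedPiece k r I j) :
    x * y ∈ gradedPiece k r I n := by
  obtain ⟨p, hp, rfl⟩ := hx
  obtain ⟨q, hq, rfl⟩ := hy
  exact ⟨p * q, hij ▸ IsHomogeneous.mul hp hq, map_mul (Ideal.Quotient.mkₐ k I) p q⟩

theorem one_mem_gradedPiece : (1 : MvPolynomial (Fin r) k ⧸ I) ∈ gradedPiece k r I 0 :=
  ⟨1, isHomogeneous_one _ _, map_one (Ideal.Quotient.mkₐ k I)⟩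

theorem eq_zero_of_socDim_eq_zero [Module.Finite k (MvPolynomial (Fin r) k ⧸ I)] {i : ℕ}
    (hsoc : socDim k r I i = 0) {x : MvPolynomial (Fin r) k ⧸ I} (hx : x ∈ gradedPiece k r I i)
    (h : ∀ y ∈ gradedPiece k r I 1, x * y = 0) : x = 0 := by
  obtain ⟨p, hp, rfl⟩ := hx
  have hbot := Submodule.finrank_eq_zero.mp hsoc
  rw [← Submodule.mem_bot k, ← hbot]
  refine Submodule.mem_map_of_mem ⟨hp, ?_⟩
  simp only [SetLike.mem_coe, Submodule.mem_iInf, Submodule.mem_comap,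
    Submodule.restrictScalars_mem, LinearMap.mulLeft_apply]
  intro j
  rw [← Ideal.Quotient.eq_zero_iff_mem, map_mul, mul_comm]
  exact h _ ⟨X j, isHomogeneous_X _ _, rfl⟩

theorem finrank_map_mulLeft_le [Module.Finite k (MvPolynomial (Fin r) k ⧸ I)]
    {L : MvPolynomial (Fin r) k ⧸ I} (hL : L ∈ gradedPiece k r I 1) (i : ℕ) :
    finrank k (Submodule.map (LinearMap.mulLeft k L) (gradedPiece k r I i)) ≤
      hilb k r I (i + 1) := by
  refine Submodule.finrank_mono ?_
  rintro _ ⟨x, hx, rfl⟩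
  exact mul_mem_gradedPiece (add_comm 1 i) hL hx

theorem finrank_map_mulLeft_of_injOn {L : MvPolynomial (Fin r) k ⧸ I} {i : ℕ}
    (h : ∀ x ∈ gradedPiece k r I i, L * x = 0 → x = 0) :
    finrank k (Submodule.map (LinearMap.mulLeft k L) (gradedPiece k r I i)) = hilb k r I i := by
  rw [← LinearMap.range_domRestrict]
  refine LinearMap.finrank_range_of_inj ((injective_iff_map_eq_zero _).mpr fun x hx => ?_)
  exact Subtype.ext (h x x.2 hx)

/-- Multiplication by `L` from degree two to degree three has rank at least the dimension in degree
one if `L` is a nonzerodivisor in degree one. -/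
theorem hilb_one_le_finrank_map_mulLeft [Module.Finite k (MvPolynomial (Fin r) k ⧸ I)]
    (hsoc : ∀ i : ℕ, i < 4 → socDim k r I i = 0) (h4 : hilb k r I 4 = 1)
    {L : MvPolynomial (Fin r) k ⧸ I} (hL : L ∈ gradedPiece k r I 1)
    (hinj : ∀ x ∈ gradedPiece k r I 1, L * x = 0 → x = 0) :
    hilb k r I 1 ≤
      finrank k (Submodule.map (LinearMap.mulLeft k L) (gradedPiece k r I 2)) := by
  set N := Submodule.map (LinearMap.mulLeft k L) (gradedPiece k r I 2)
  have hN : ∀ n ∈ N, n ∈ gradedPiece k r I 3 := by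
    rintro _ ⟨x, hx, rfl⟩
    exact mul_mem_gradedPiece rfl hL hx
  let φ : gradedPiece k r I 1 →ₗ[k] N →ₗ[k] gradedPiece k r I 4 :=
    LinearMap.mk₂ k (fun y n => ⟨y * n, mul_mem_gradedPiece rfl y.2 (hN n n.2)⟩)
      (fun _ _ _ => Subtype.ext (add_mul _ _ _)) (fun _ _ _ => Subtype.ext (smul_mul_assoc _ _ _))
      (fun _ _ _ => Subtype.ext (mul_add _ _ _)) (fun _ _ _ => Subtype.ext (mul_smul_comm _ _ _))
  have hφ : Function.Injective φ := by
    refine (injective_iff_map_eq_zero _).mpr fun y hy => Subtype.ext (hinj y y.2 ?_)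
    have hLy : L * y ∈ gradedPiece k r I 2 := mul_mem_gradedPiece rfl hL y.2
    refine eq_zero_of_socDim_eq_zero (hsoc 2 (by norm_num)) hLy fun z hz => ?_
    refine eq_zero_of_socDim_eq_zero (hsoc 3 (by norm_num))
      (mul_mem_gradedPiece rfl hLy hz) fun w hw => ?_
    have h := congrArg Subtype.val (LinearMap.congr_fun hy
      ⟨L * (z * w), Submodule.mem_map_of_mem (mul_mem_gradedPiece rfl hz hw)⟩)
    have h' : (y : MvPolynomial (Fin r) k ⧸ I) * (L * (z * w)) = 0 := h
    linear_combination h'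
  have := LinearMap.finrank_le_finrank_of_injective hφ
  rwa [Module.finrank_linearMap, show finrank k (gradedPiece k r I 4) = 1 from h4, mul_one] at this

end GradedPieces

/-- Proposition 3.6: every standard graded artinian Gorenstein algebra with
Hilbert function `(1, 4, a, 4, 1)` has the weak Lefschetz property. -/
theorem gorenstein_1_4_a_4_1_wlp
    (k : Type*) [Field k] [Infinite k] (hchar : (2 : k) ≠ 0)
    (r a : ℕ)
    (I : Ideal (MvPolynomial (Fin r) k))
    (hlin : NoLinearForms I) (hGor : Gorenstein k r 4 I)
    (h0 : hilb k r I 0 = 1) (h1 : hilb k r I 1 = 4) (h2 : hilb k r I 2 = a)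
    (h3 : hilb k r I 3 = 4) (h4 : hilb k r I 4 = 1) :
    WLP k r 4 I := by
  obtain ⟨⟨-, hfin⟩, -, hsoc, -⟩ := hGor
  obtain ⟨⟨L, hL⟩, hLinj⟩ := exists_forall_mul_eq_zero (V := gradedPiece k r I 1)
    (fun x y h => eq_zero_of_socDim_eq_zero (hsoc 2 (by norm_num))
      (mul_mem_gradedPiece rfl x.2 y.2) fun z hz => h ⟨z, hz⟩)
    (fun x h => Subtype.ext (eq_zero_of_socDim_eq_zero (hsoc 1 (by norm_num)) x.2
      fun y hy => h ⟨y, hy⟩)) hchar h1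
  have hinj : ∀ x ∈ gradedPiece k r I 1, L * x = 0 → x = 0 := fun x hx h =>
    congrArg Subtype.val (hLinj ⟨x, hx⟩ h)
  have hL0 : L ≠ 0 := by
    rintro rfl
    have hbot : gradedPiece k r I 1 = ⊥ :=
      (Submodule.eq_bot_iff _).mpr fun x hx => hinj x hx (zero_mul x)
    rw [hilb, hbot, finrank_bot] at h1
    omega
  have hpos : ∀ i, (∃ x ∈ gradedPiece k r I i, L * x ≠ 0) → 1 ≤ Module.finrank k
      (Submodule.map (LinearMap.mulLeft k L) (gradedPiece k r I i)) := by
    rintro i ⟨x, hx, hne⟩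
    exact Submodule.one_le_finrank_iff.mpr ((Submodule.ne_bot_iff _).mpr
      ⟨L * x, Submodule.mem_map_of_mem hx, hne⟩)
  have hle : ∀ i, Module.finrank k
      (Submodule.map (LinearMap.mulLeft k L) (gradedPiece k r I i)) ≤ hilb k r I i :=
    fun i => Submodule.finrank_map_le _ _
  have hle' := finrank_map_mulLeft_le hL
  have r0 := hpos 0 ⟨1, one_mem_gradedPiece, by rwa [mul_one]⟩
  have r1 := finrank_map_mulLeft_of_injOn hinj
  have r2 := hilb_one_le_finrank_map_mulLeft hsoc h4 hL hinj
  have r3 := hpos 3 <| by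
    by_contra! hcon
    refine hL0 (eq_zero_of_socDim_eq_zero (hsoc 1 (by norm_num)) hL fun x hx => ?_)
    refine eq_zero_of_socDim_eq_zero (hsoc 2 (by norm_num))
      (mul_mem_gradedPiece rfl hL hx) fun y hy => ?_
    refine eq_zero_of_socDim_eq_zero (hsoc 3 (by norm_num))
      (mul_mem_gradedPiece rfl (mul_mem_gradedPiece rfl hL hx) hy) fun z hz => ?_
    have := hcon (x * y * z) (mul_mem_gradedPiece rfl (mul_mem_gradedPiece rfl hx hy) hz)
    linear_combination this
  obtain ⟨p, hp, rfl⟩ := hL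
  refine ⟨p, hp, fun i hi => ?_⟩
  refine le_antisymm (le_min (hle i) (hle' i)) ?_
  change min _ _ ≤ Module.finrank k (Submodule.map
    (LinearMap.mulLeft k ((Ideal.Quotient.mkₐ k I).toLinearMap p)) (gradedPiece k r I i))
  interval_cases i
  · exact (min_le_left _ _).trans (h0.trans_le r0)
  · exact (min_le_left _ _).trans r1.ge
  · exact (min_le_right _ _).trans ((h3.trans h1.symm).trans_le r2)
  · exact (min_le_right _ _).trans (h4.trans_le r3)
end
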